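/- arXiv:2509.23351 — 5 statements merged into one kernel-verified Lean document; each statement's English description precedes it below -/
import Mathlib

section
/- Let (Ω,𝓕,μ) be a finite probability space, I a finite set, and (𝓕_i)_{i∈I} a family of sub-σ-algebras of 𝓕 having the 2-Doob property with constant δ > 0, i.e. δ·‖sup_{i∈I}|E(g|𝓕_i)|‖_{L²} ≤ ‖g‖_{L²} for all g ∈ L²(Ω). Let J be a finite set, and for (i,j) ∈ I×J let w_{i,j} : Ω → [0,1] be measurable functions and f_{i,j} be 𝓕_i-measurable functions. Then for every κ > 0: E[(Σ_{(i,j)∈I×J} (w_{i,j} f_{i,j})²)^{1/2}] ≥ κ²·δ · E[(Σ_{(i,j)∈I×J} 1_{{E(w_{i,j}|𝓕_i) ≥ κ}} f_{i,j}²)^{1/2}]. -/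
open MeasureTheory

noncomputable section

/-- Real-valued measurable functions on a finite type are integrable for any finite measure. -/
lemma integrable_of_measurable_of_finite {Ω : Type*} [Finite Ω] [MeasurableSpace Ω]
    (μ : Measure Ω) [IsFiniteMeasure μ] {g : Ω → ℝ} (hg : Measurable g) : Integrable g μ := by
  obtain ⟨C, hC⟩ := (Set.finite_range fun x => ‖g x‖).bddAbove
  exact Integrable.of_bound hg.aestronglyMeasurable C
    (ae_of_all _ fun x => hC (Set.mem_range_self x))

lemma integral_mul_condExp_of_finite {Ω : Type*} [Finite Ω] {m m₀ : MeasurableSpace Ω}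
    (hm : m ≤ m₀) (μ : Measure Ω) [IsFiniteMeasure μ] {u g : Ω → ℝ}
    (hu : Measurable[m] u) (hg : Measurable g) :
    ∫ x, u x * (μ[g|m]) x ∂μ = ∫ x, u x * g x ∂μ := by
  have hpull : μ[u * g|m] =ᵐ[μ] u * μ[g|m] :=
    condExp_mul_of_stronglyMeasurable_left hu.stronglyMeasurable
      (integrable_of_measurable_of_finite μ ((hu.mono hm le_rfl).mul hg))
      (integrable_of_measurable_of_finite μ hg)
  calc ∫ x, u x * (μ[g|m]) x ∂μ = ∫ x, (μ[u * g|m]) x ∂μ := (integral_congr_ae hpull).symm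
    _ = ∫ x, u x * g x ∂μ := integral_condExp hm

lemma le_condExp_of_le_of_finite {Ω : Type*} [Finite Ω] {m m₀ : MeasurableSpace Ω}
    (hm : m ≤ m₀) (μ : Measure Ω) [IsFiniteMeasure μ] {g : Ω → ℝ} (hg : Measurable g) {c : ℝ}
    (hc : ∀ x, c ≤ g x) : ∀ᵐ x ∂μ, c ≤ (μ[g|m]) x := by
  have h := condExp_mono (m := m) (integrable_const (μ := μ) c)
    (integrable_of_measurable_of_finite μ hg) (ae_of_all _ hc)
  rwa [condExp_const hm] at h

lemma condExp_le_of_le_of_finite {Ω : Type*} [Finite Ω] {m m₀ : MeasurableSpace Ω}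
    (hm : m ≤ m₀) (μ : Measure Ω) [IsFiniteMeasure μ] {g : Ω → ℝ} (hg : Measurable g) {c : ℝ}
    (hc : ∀ x, g x ≤ c) : ∀ᵐ x ∂μ, (μ[g|m]) x ≤ c := by
  have h := condExp_mono (m := m) (integrable_of_measurable_of_finite μ hg)
    (integrable_const (μ := μ) c) (ae_of_all _ hc)
  rwa [condExp_const hm] at h

/-- A linearised form of Hölder's inequality `(E w)³ ≤ E (w³ / g²) (E g)²`. -/
lemma three_mul_sq_mul_sub_le_sq_div_sq {a w g : ℝ} (ha : 0 ≤ a) (hw0 : 0 ≤ w) (hw1 : w ≤ 1)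
    (hg : 0 < g) : 3 * a ^ 2 * w - 2 * a ^ 3 * g ≤ w ^ 2 / g ^ 2 := by
  have hy : 0 ≤ w / g := by positivity
  have hcube : 0 ≤ (w / g - a) ^ 2 * (w / g + 2 * a) * g := by positivity
  have hwy : w / g * g = w := div_mul_cancel₀ w hg.ne'
  have hle : w * (w / g) ^ 2 ≤ (w / g) ^ 2 := mul_le_of_le_one_left (sq_nonneg _) hw1
  rw [← div_pow]
  linear_combination hcube + hle + ((w / g) ^ 2 - 3 * a ^ 2) * hwy

lemma integral_ite_div_condExp_sq_le {Ω : Type*} [Finite Ω] {m m₀ : MeasurableSpace Ω}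
    (hm : m ≤ m₀) (μ : Measure Ω) [IsFiniteMeasure μ] {w f g : Ω → ℝ}
    (hw : ∀ x, w x ∈ Set.Icc (0 : ℝ) 1) (hwm : Measurable w) (hf : Measurable[m] f)
    (hgm : Measurable g) {c : ℝ} (hc : 0 < c) (hg : ∀ x, c ≤ g x) {κ : ℝ} (hκ : 0 < κ) :
    κ ^ 4 * ∫ x, (if κ ≤ (μ[w|m]) x then f x ^ 2 else 0) / (μ[g|m]) x ^ 2 ∂μ ≤
      ∫ x, (w x * f x) ^ 2 / g x ^ 2 ∂μ := by
  have hW : Measurable[m] (μ[w|m]) := stronglyMeasurable_condExp.measurable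
  have hG : Measurable[m] (μ[g|m]) := stronglyMeasurable_condExp.measurable
  set u : Ω → ℝ := fun x => if κ ≤ (μ[w|m]) x then f x ^ 2 else 0 with hu
  set a : Ω → ℝ := fun x => κ / (μ[g|m]) x with ha
  have hum : Measurable[m] u :=
    Measurable.ite (measurableSet_le measurable_const hW) (hf.pow_const 2) measurable_const
  have ham : Measurable[m] a := measurable_const.div hG
  have hu0 (x) : 0 ≤ u x := by simp only [hu]; split_ifs <;> positivity
  have hp : Measurable[m] fun x => 3 * (u x * a x ^ 2) :=
    measurable_const.mul (hum.mul (ham.pow_const 2))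
  have hq : Measurable[m] fun x => 2 * (u x * a x ^ 3) :=
    measurable_const.mul (hum.mul (ham.pow_const 3))
  have hInt {v : Ω → ℝ} (hv : Measurable v) : Integrable v μ :=
    integrable_of_measurable_of_finite μ hv
  have hp₀ := hp.mono hm le_rfl
  have hq₀ := hq.mono hm le_rfl
  have hu₀ := hum.mono hm le_rfl
  have hW₀ := hW.mono hm le_rfl
  have hG₀ := hG.mono hm le_rfl
  have hf₀ := hf.mono hm le_rfl
  have hGc := le_condExp_of_le_of_finite hm μ hgm hg
  have hW1 := condExp_le_of_le_of_finite hm μ hwm fun x => (hw x).2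
  calc κ ^ 4 * ∫ x, u x / (μ[g|m]) x ^ 2 ∂μ
      = ∫ x, κ ^ 4 * (u x / (μ[g|m]) x ^ 2) ∂μ := (integral_const_mul _ _).symm
    _ ≤ ∫ x, (3 * (u x * a x ^ 2) * (μ[w|m]) x - 2 * (u x * a x ^ 3) * (μ[g|m]) x) ∂μ := by
        refine integral_mono_ae (hInt (measurable_const.mul (hu₀.div (hG₀.pow_const 2))))
          (hInt ((hp₀.mul hW₀).sub (hq₀.mul hG₀))) ?_
        filter_upwards [hGc, hW1] with x hGx hWx
        have hGpos : 0 < (μ[g|m]) x := hc.trans_le hGx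
        have hrw : 3 * (u x * a x ^ 2) * (μ[w|m]) x - 2 * (u x * a x ^ 3) * (μ[g|m]) x =
            (3 * κ ^ 2 * (μ[w|m]) x - 2 * κ ^ 3) * (u x / (μ[g|m]) x ^ 2) := by
          simp only [ha]
          field_simp
        rw [hrw]
        by_cases hx : κ ≤ (μ[w|m]) x
        · refine mul_le_mul_of_nonneg_right ?_ (div_nonneg (hu0 x) (sq_nonneg _))
          have h₁ : κ ^ 4 ≤ κ ^ 3 := pow_le_pow_of_le_one hκ.le (hx.trans hWx) (by norm_num)
          have h₂ : κ ^ 2 * κ ≤ κ ^ 2 * (μ[w|m]) x := by gcongr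
          linarith
        · simp [hu, hx]
    _ = ∫ x, (3 * (u x * a x ^ 2) * w x - 2 * (u x * a x ^ 3) * g x) ∂μ := by
        rw [integral_sub (hInt (hp₀.fun_mul hW₀)) (hInt (hq₀.fun_mul hG₀)),
          integral_sub (hInt (hp₀.fun_mul hwm)) (hInt (hq₀.fun_mul hgm)),
          integral_mul_condExp_of_finite hm μ hp hwm, integral_mul_condExp_of_finite hm μ hq hgm]
    _ ≤ ∫ x, (w x * f x) ^ 2 / g x ^ 2 ∂μ := by
        refine integral_mono_ae (hInt ((hp₀.mul hwm).sub (hq₀.mul hgm)))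
          (hInt (((hwm.mul hf₀).pow_const 2).div (hgm.pow_const 2))) ?_
        filter_upwards [hGc] with x hGx
        have ha0 : 0 ≤ a x := div_nonneg hκ.le (hc.le.trans hGx)
        have huf : u x ≤ f x ^ 2 := by
          simp only [hu]; split_ifs
          exacts [le_rfl, sq_nonneg _]
        calc 3 * (u x * a x ^ 2) * w x - 2 * (u x * a x ^ 3) * g x
            = u x * (3 * a x ^ 2 * w x - 2 * a x ^ 3 * g x) := by ring
          _ ≤ u x * (w x ^ 2 / g x ^ 2) := mul_le_mul_of_nonneg_left
              (three_mul_sq_mul_sub_le_sq_div_sq ha0 (hw x).1 (hw x).2 (hc.trans_le (hg x)))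
              (hu0 x)
          _ ≤ f x ^ 2 * (w x ^ 2 / g x ^ 2) := mul_le_mul_of_nonneg_right huf (by positivity)
          _ = (w x * f x) ^ 2 / g x ^ 2 := by ring

/-- main lemma: if a finite family `(𝓕_i)_{i ∈ I}` of sub-σ-algebras of a
finite probability space has the 2-Doob property with constant `δ`, `w_{i,j}` are
`[0,1]`-valued weights, and `f_{i,j}` is `𝓕_i`-measurable, then for every `κ > 0`,
`E (Σ_{i,j} (w_{i,j} f_{i,j})²)^{1/2} ≥ κ² δ E (Σ_{i,j} 1_{{E(w_{i,j}|𝓕_i) ≥ κ}} f_{i,j}²)^{1/2}`. -/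
theorem statement4 {Ω : Type} [Fintype Ω] [MeasurableSpace Ω]
    (μ : Measure Ω) [IsProbabilityMeasure μ]
    {I J : Type} [Fintype I] [Fintype J]
    (𝓕 : I → MeasurableSpace Ω) (h𝓕 : ∀ i, 𝓕 i ≤ ‹MeasurableSpace Ω›)
    (δ : ℝ) (hδ : 0 < δ)
    (hDoob : ∀ g : Ω → ℝ,
      δ * Real.sqrt (∫ x, (⨆ i, |(μ[g|𝓕 i]) x|) ^ 2 ∂μ) ≤ Real.sqrt (∫ x, g x ^ 2 ∂μ))
    (w f : I → J → Ω → ℝ)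
    (hw : ∀ i j x, w i j x ∈ Set.Icc (0 : ℝ) 1)
    (hwm : ∀ i j, Measurable (w i j))
    (hf : ∀ i j, Measurable[𝓕 i] (f i j))
    (κ : ℝ) (hκ : 0 < κ) :
    ∫ x, Real.sqrt (∑ i : I, ∑ j : J, (w i j x * f i j x) ^ 2) ∂μ ≥
      κ ^ 2 * δ * ∫ x, Real.sqrt (∑ i : I, ∑ j : J,
        if κ ≤ (μ[w i j|𝓕 i]) x then (f i j x) ^ 2 else 0) ∂μ := by
  have hInt {v : Ω → ℝ} (hv : Measurable v) : Integrable v μ :=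
    integrable_of_measurable_of_finite μ hv
  have hf₀ (i j) : Measurable (f i j) := (hf i j).mono (h𝓕 i) le_rfl
  set S : Ω → ℝ := fun x => √(∑ i : I, ∑ j : J, (w i j x * f i j x) ^ 2) with hS
  set h : I → J → Ω → ℝ := fun i j x => if κ ≤ (μ[w i j|𝓕 i]) x then (f i j x) ^ 2 else 0 with hh
  have hSm : Measurable S := Measurable.sqrt <| Finset.measurable_fun_sum _ fun i _ =>
    Finset.measurable_fun_sum _ fun j _ => ((hwm i j).mul (hf₀ i j)).pow_const 2
  have hhm (i j) : Measurable (h i j) :=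
    Measurable.ite (measurableSet_le measurable_const
      (stronglyMeasurable_condExp.measurable.mono (h𝓕 i) le_rfl))
      ((hf₀ i j).pow_const 2) measurable_const
  have hh0 (i j x) : 0 ≤ h i j x := by simp only [hh]; split_ifs <;> positivity
  have hS0 (x) : 0 ≤ S x := Real.sqrt_nonneg _
  have hSsq (x) : S x ^ 2 = ∑ i : I, ∑ j : J, (w i j x * f i j x) ^ 2 :=
    Real.sq_sqrt (Finset.sum_nonneg fun i _ => Finset.sum_nonneg fun j _ => sq_nonneg _)
  refine le_of_forall_pos_le_add fun ε hε => ?_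
  set g : Ω → ℝ := fun x => √(S x + ε) with hg
  have hgm : Measurable g := (hSm.add_const ε).sqrt
  have hgε (x) : √ε ≤ g x := Real.sqrt_le_sqrt (by linarith [hS0 x])
  have hgsq (x) : g x ^ 2 = S x + ε := Real.sq_sqrt (by linarith [hS0 x])
  have hεpos : 0 < √ε := Real.sqrt_pos.2 hε
  set G : I → Ω → ℝ := fun i => μ[g|𝓕 i] with hG
  have hGm (i) : Measurable (G i) := stronglyMeasurable_condExp.measurable.mono (h𝓕 i) le_rfl
  set M : Ω → ℝ := fun x => ⨆ i, |G i x| with hM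
  have hMm : Measurable M := Measurable.iSup fun i => continuous_abs.measurable.comp (hGm i)
  have hM0 (x) : 0 ≤ M x := Real.iSup_nonneg fun i => abs_nonneg _
  set Q : Ω → ℝ := fun x => ∑ i : I, ∑ j : J, h i j x / G i x ^ 2 with hQ
  have hQm' (i j) : Measurable fun x => h i j x / G i x ^ 2 :=
    (hhm i j).div ((hGm i).pow_const 2)
  have hQm : Measurable Q := Finset.measurable_fun_sum _ fun i _ =>
    Finset.measurable_fun_sum _ fun j _ => hQm' i j
  have hQ0 (x) : 0 ≤ Q x := Finset.sum_nonneg fun i _ => Finset.sum_nonneg fun j _ =>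
    div_nonneg (hh0 i j x) (sq_nonneg _)
  have hSε : ∫ x, g x ^ 2 ∂μ = ∫ x, S x ∂μ + ε := by
    simp_rw [hgsq]
    rw [integral_add (hInt hSm) (integrable_const ε)]
    simp
  have hMle : δ ^ 2 * ∫ x, M x ^ 2 ∂μ ≤ ∫ x, S x ∂μ + ε := by
    rw [← hSε]
    have h₁ := pow_le_pow_left₀ (by positivity) (hDoob g) 2
    rwa [mul_pow, Real.sq_sqrt (integral_nonneg fun x => sq_nonneg _),
      Real.sq_sqrt (integral_nonneg fun x => sq_nonneg _)] at h₁
  have hQle : κ ^ 4 * ∫ x, Q x ∂μ ≤ ∫ x, S x ∂μ := by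
    have hRm (i j) : Measurable fun x => (w i j x * f i j x) ^ 2 / g x ^ 2 :=
      (((hwm i j).mul (hf₀ i j)).pow_const 2).div (hgm.pow_const 2)
    calc κ ^ 4 * ∫ x, Q x ∂μ = ∑ i : I, ∑ j : J, κ ^ 4 * ∫ x, h i j x / G i x ^ 2 ∂μ := by
          simp only [hQ]
          rw [integral_finsetSum _ fun i _ => hInt (Finset.measurable_fun_sum _ fun j _ => hQm' i j),
            Finset.mul_sum]
          refine Finset.sum_congr rfl fun i _ => ?_
          rw [integral_finsetSum _ fun j _ => hInt (hQm' i j), Finset.mul_sum]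
      _ ≤ ∑ i : I, ∑ j : J, ∫ x, (w i j x * f i j x) ^ 2 / g x ^ 2 ∂μ :=
          Finset.sum_le_sum fun i _ => Finset.sum_le_sum fun j _ =>
            integral_ite_div_condExp_sq_le (h𝓕 i) μ (hw i j) (hwm i j) (hf i j) hgm hεpos hgε hκ
      _ = ∫ x, ∑ i : I, ∑ j : J, (w i j x * f i j x) ^ 2 / g x ^ 2 ∂μ := by
          rw [integral_finsetSum _ fun i _ => hInt (Finset.measurable_fun_sum _ fun j _ => hRm i j)]
          refine Finset.sum_congr rfl fun i _ => ?_
          rw [integral_finsetSum _ fun j _ => hInt (hRm i j)]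
      _ ≤ ∫ x, S x ∂μ := by
          refine integral_mono (hInt (Finset.measurable_fun_sum _ fun i _ =>
            Finset.measurable_fun_sum _ fun j _ => hRm i j)) (hInt hSm) fun x => ?_
          simp only [← Finset.sum_div]
          rw [← hSsq, hgsq, div_le_iff₀ (by linarith [hS0 x])]
          nlinarith [hS0 x]
  have hT : ∀ᵐ x ∂μ, 2 * (κ ^ 2 * δ) * √(∑ i : I, ∑ j : J, h i j x) ≤
      κ ^ 4 * Q x + δ ^ 2 * M x ^ 2 := by
    have hGpos : ∀ᵐ x ∂μ, ∀ i, √ε ≤ G i x :=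
      ae_all_iff.2 fun i => le_condExp_of_le_of_finite (h𝓕 i) μ hgm hgε
    filter_upwards [hGpos] with x hx
    have hsum : ∑ i : I, ∑ j : J, h i j x ≤ M x ^ 2 * Q x := by
      simp only [hQ, Finset.mul_sum]
      refine Finset.sum_le_sum fun i _ => Finset.sum_le_sum fun j _ => ?_
      have hGi : 0 < G i x := hεpos.trans_le (hx i)
      have hGM : G i x ≤ M x :=
        (le_abs_self _).trans (le_ciSup (f := fun i => |G i x|) (Set.finite_range _).bddAbove i)
      rw [mul_div_assoc', le_div_iff₀ (by positivity), mul_comm]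
      exact mul_le_mul_of_nonneg_right (by gcongr) (hh0 i j x)
    have hsqrt : √(∑ i : I, ∑ j : J, h i j x) ≤ M x * √(Q x) := by
      rw [← Real.sqrt_sq (hM0 x), ← Real.sqrt_mul (sq_nonneg _)]
      exact Real.sqrt_le_sqrt hsum
    have hmul := mul_le_mul_of_nonneg_left hsqrt (by positivity : 0 ≤ 2 * (κ ^ 2 * δ))
    have hsq := sq_nonneg (κ ^ 2 * √(Q x) - δ * M x)
    linear_combination hmul + hsq + κ ^ 4 * Real.sq_sqrt (hQ0 x)
  have hTm : Measurable fun x => √(∑ i : I, ∑ j : J, h i j x) :=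
    Measurable.sqrt <| Finset.measurable_fun_sum _ fun i _ =>
      Finset.measurable_fun_sum _ fun j _ => hhm i j
  have hTle := integral_mono_ae (hInt (measurable_const.fun_mul hTm))
    (hInt ((measurable_const.fun_mul hQm).fun_add (measurable_const.fun_mul (hMm.pow_const 2)))) hT
  rw [integral_const_mul, integral_add (hInt (measurable_const.fun_mul hQm))
    (hInt (measurable_const.fun_mul (hMm.pow_const 2))), integral_const_mul, integral_const_mul] at hTle
  linarith

end
end

section
/- Let (Ω,𝓕,μ) be a probability space and let (f_{i,j})_{i,j≥0} be functions adapted to the canonical two-parameter product filtration on Ω^ℕ × Ω^ℕ, i.e. f_{i,j} depends only on the coordinates (x_0,…,x_i) and (y_0,…,y_j), with only finitely many f_{i,j} nonzero. Then, with absolute implied constants, ∫_{Ω^ℕ×Ω^ℕ} (Σ_{i,j} f_{i,j}(x_{≤i}, y_{≤j})²)^{1/2} dx dy ≃ ∫_{Ω^ℕ×Ω^ℕ} ∫_{Ω^ℕ} ∫_{Ω^ℕ} (Σ_{i,j} f_{i,j}((x_{<i},η_i),(y_{<j},θ_j))²)^{1/2} dη dθ dx dy, where in the right-hand side the last coordinates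 x_i and y_j are replaced by coordinates η_i, θ_j of independent copies η, θ of x, y. -/
open MeasureTheory

noncomputable section

/-- The canonical one-parameter product filtration on `Ω^ℕ`:
`𝓕 i = σ(x ↦ (x_0, …, x_i))`. -/
def canonF (Ω : Type) [MeasurableSpace Ω] (i : ℕ) : MeasurableSpace (ℕ → Ω) :=
  MeasurableSpace.comap (fun x (k : Fin (i + 1)) => x k) inferInstance

/-- The canonical two-parameter product filtration on `Ω^ℕ × Ω^ℕ`:
`𝓕_{i,j} = 𝓕_i ⊗ 𝓕_j`. -/
def canonF2 (Ω : Type) [MeasurableSpace Ω] (i j : ℕ) :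
    MeasurableSpace ((ℕ → Ω) × (ℕ → Ω)) :=
  (canonF Ω i).prod (canonF Ω j)

namespace Decoupling

/-- Increments of the square root decrease in the base point. -/
lemma sqrt_add_add_sqrt_le {s t c : ℝ} (hs : 0 ≤ s) (hst : s ≤ t) (hc : 0 ≤ c) :
    √(t + c) + √s ≤ √(s + c) + √t := by
  have h : √(t + c) * √s ≤ √(s + c) * √t := by
    rw [← Real.sqrt_mul (by linarith), ← Real.sqrt_mul (by linarith)]
    exact Real.sqrt_le_sqrt (by nlinarith)
  refine le_of_sq_le_sq ?_ (by positivity)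
  have h1 := Real.sq_sqrt (show 0 ≤ t + c by linarith)
  have h2 := Real.sq_sqrt (show 0 ≤ s + c by linarith)
  have h3 := Real.sq_sqrt hs
  have h4 := Real.sq_sqrt (show 0 ≤ t by linarith)
  nlinarith

lemma sqrt_add_le {s t : ℝ} (hs : 0 ≤ s) (ht : 0 ≤ t) : √(s + t) ≤ √s + √t := by
  simpa [add_comm (√t)] using sqrt_add_add_sqrt_le le_rfl hs ht

lemma integrable_sqrt_sum {W ι : Type*} [MeasurableSpace W] {m : Measure W} {a : ι → W → ℝ}
    (a_nonneg : ∀ i w, 0 ≤ a i w) (a_meas : ∀ i, Measurable (a i))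
    (a_int : ∀ i, Integrable (fun w => √(a i w)) m) (s : Finset ι) :
    Integrable (fun w => √(∑ i ∈ s, a i w)) m := by
  classical
  refine (integrable_finsetSum s fun i _ => a_int i).mono'
    (Finset.measurable_sum s fun i _ => a_meas i).sqrt.aestronglyMeasurable
    (Filter.Eventually.of_forall fun w => ?_)
  rw [Real.norm_of_nonneg (Real.sqrt_nonneg _)]
  induction s using Finset.induction_on with
  | empty => simp
  | insert i s hi ih =>
    rw [Finset.sum_insert hi, Finset.sum_insert hi]
    exact (sqrt_add_le (a_nonneg i w)
      (Finset.sum_nonneg fun k _ => a_nonneg k w)).trans (by gcongr)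

/-- If the measure preserving map `σ i` exchanges `a i` for `b i` without changing the earlier
terms of `b`, then the square function of `a` is dominated by that of `b`. -/
lemma integral_sqrt_sum_le {W : Type*} [MeasurableSpace W] {m : Measure W} {a b : ℕ → W → ℝ}
    (a_nonneg : ∀ i w, 0 ≤ a i w) (b_nonneg : ∀ i w, 0 ≤ b i w)
    (a_meas : ∀ i, Measurable (a i)) (b_meas : ∀ i, Measurable (b i))
    (a_int : ∀ i, Integrable (fun w => √(a i w)) m)
    (b_int : ∀ i, Integrable (fun w => √(b i w)) m)
    {σ : ℕ → W → W} (hσ : ∀ i, MeasurePreserving (σ i) m m)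
    (hab : ∀ i w, a i (σ i w) = b i w) (hb : ∀ i, ∀ k < i, ∀ w, b k (σ i w) = b k w) (N : ℕ) :
    ∫ w, √(∑ i ∈ Finset.range N, a i w) ∂m ≤ 2 * ∫ w, √(∑ i ∈ Finset.range N, b i w) ∂m := by
  set A : ℕ → W → ℝ := fun n w => ∑ i ∈ Finset.range n, a i w with hA
  set B : ℕ → W → ℝ := fun n w => ∑ i ∈ Finset.range n, b i w with hB
  have A_nonneg n w : 0 ≤ A n w := Finset.sum_nonneg fun i _ => a_nonneg i w
  have B_nonneg n w : 0 ≤ B n w := Finset.sum_nonneg fun i _ => b_nonneg i w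
  have A_meas n : Measurable (A n) := Finset.measurable_sum _ fun i _ => a_meas i
  have B_meas n : Measurable (B n) := Finset.measurable_sum _ fun i _ => b_meas i
  have A_int n : Integrable (fun w => √(A n w)) m := integrable_sqrt_sum a_nonneg a_meas a_int _
  have B_int n : Integrable (fun w => √(B n w)) m := integrable_sqrt_sum b_nonneg b_meas b_int _
  have add_int {u v : W → ℝ} (hu0 : ∀ w, 0 ≤ u w) (hv0 : ∀ w, 0 ≤ v w) (hum : Measurable u)
      (hvm : Measurable v) (hu : Integrable (fun w => √(u w)) m)
      (hv : Integrable (fun w => √(v w)) m) : Integrable (fun w => √(u w + v w)) m := by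
    refine (hu.add hv).mono' (hum.add hvm).sqrt.aestronglyMeasurable
      (Filter.Eventually.of_forall fun w => ?_)
    rw [Real.norm_of_nonneg (Real.sqrt_nonneg _)]
    exact sqrt_add_le (hu0 w) (hv0 w)
  have AB_int n : Integrable (fun w => √(A n w + B n w)) m :=
    add_int (A_nonneg n) (B_nonneg n) (A_meas n) (B_meas n) (A_int n) (B_int n)
  have Ba_int n : Integrable (fun w => √(B n w + a n w)) m :=
    add_int (B_nonneg n) (a_nonneg n) (B_meas n) (a_meas n) (B_int n) (a_int n)
  have exchange n : ∫ w, √(B n w + a n w) ∂m = ∫ w, √(B (n + 1) w) ∂m := by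
    have h := integral_map (hσ n).measurable.aemeasurable (μ := m)
      (f := fun w => √(B n w + a n w)) ((B_meas n).add (a_meas n)).sqrt.aestronglyMeasurable
    rw [(hσ n).map_eq] at h
    rw [h]
    refine integral_congr_ae (Filter.Eventually.of_forall fun w => ?_)
    have hBσ : B n (σ n w) = B n w :=
      Finset.sum_congr rfl fun k hk => hb n k (Finset.mem_range.1 hk) w
    have hsucc : B (n + 1) w = B n w + b n w := Finset.sum_range_succ _ _
    simp only [hBσ, hab, hsucc]
  have key n : ∫ w, √(A n w + B n w) ∂m ≤ 2 * ∫ w, √(B n w) ∂m := by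
    induction n with
    | zero => simp [hA, hB]
    | succ n ih =>
      have pointwise w : √(A (n + 1) w + B (n + 1) w) + 2 * √(B n w) ≤
          √(A n w + B n w) + (√(B n w + a n w) + √(B (n + 1) w)) := by
        have hsA : A (n + 1) w = A n w + a n w := Finset.sum_range_succ _ _
        have hsB : B (n + 1) w = B n w + b n w := Finset.sum_range_succ _ _
        have ha0 := a_nonneg n w
        have hb0 := b_nonneg n w
        have hA0 := A_nonneg n w
        have hB0 := B_nonneg n w
        have h1 := sqrt_add_add_sqrt_le (s := B n w) (t := A n w + B n w) (c := a n w + b n w)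
          hB0 (by linarith) (by linarith)
        have h2 := sqrt_add_add_sqrt_le (s := B n w) (t := B n w + a n w) (c := b n w)
          hB0 (by linarith) hb0
        rw [hsA, hsB, show A n w + a n w + (B n w + b n w) =
          A n w + B n w + (a n w + b n w) by ring]
        rw [← add_assoc (B n w)] at h1
        linarith
      have h := integral_mono ((AB_int (n + 1)).add ((B_int n).const_mul 2))
        ((AB_int n).add ((Ba_int n).add (B_int (n + 1)))) pointwise
      rw [integral_add' (AB_int (n + 1)) ((B_int n).const_mul 2),
        integral_add' (AB_int n) ((Ba_int n).add (B_int (n + 1))),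
        integral_add' (Ba_int n) (B_int (n + 1)), integral_const_mul, exchange n] at h
      linarith
  refine le_trans (integral_mono (A_int N) (AB_int N) fun w => ?_) (key N)
  exact Real.sqrt_le_sqrt (by linarith [B_nonneg N w])

variable {Ω : Type*} [MeasurableSpace Ω]

/-- Exchange the `i`-th coordinates of two sequences. -/
def swapAt (i : ℕ) (p : (ℕ → Ω) × (ℕ → Ω)) : (ℕ → Ω) × (ℕ → Ω) :=
  (Function.update p.1 i (p.2 i), Function.update p.2 i (p.1 i))

lemma measurable_swapAt (i : ℕ) : Measurable (swapAt (Ω := Ω) i) := by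
  have h (u v : (ℕ → Ω) × (ℕ → Ω) → ℕ → Ω) (hu : Measurable u) (hv : Measurable v) :
      Measurable fun p => Function.update (u p) i (v p i) := by
    refine measurable_pi_lambda _ fun k => ?_
    by_cases hk : k = i
    · subst hk; simpa using measurable_pi_iff.1 hv k
    · simpa [hk] using measurable_pi_iff.1 hu k
  exact (h _ _ measurable_fst measurable_snd).prodMk (h _ _ measurable_snd measurable_fst)

lemma measurePreserving_swapAt (μ : Measure Ω) [IsProbabilityMeasure μ] (i : ℕ) :
    MeasurePreserving (swapAt i)
      ((Measure.infinitePi fun _ : ℕ => μ).prod (Measure.infinitePi fun _ : ℕ => μ))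
      ((Measure.infinitePi fun _ : ℕ => μ).prod (Measure.infinitePi fun _ : ℕ => μ)) := by
  classical
  refine ⟨measurable_swapAt i, Eq.symm ?_⟩
  set ν := Measure.infinitePi fun _ : ℕ => μ with hν
  have univ_mem : (Set.univ : Set (ℕ → Ω)) ∈
      squareCylinders fun _ : ℕ => {s : Set Ω | MeasurableSet s} :=
    ⟨∅, fun _ => Set.univ, by simp, by simp⟩
  have pi_sys : IsPiSystem (squareCylinders fun _ : ℕ => {s : Set Ω | MeasurableSet s}) :=
    isPiSystem_squareCylinders (fun _ => MeasurableSpace.isPiSystem_measurableSet) (by simp)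
  have spanning : ν.FiniteSpanningSetsIn
      (squareCylinders fun _ : ℕ => {s : Set Ω | MeasurableSet s}) :=
    ⟨fun _ => Set.univ, fun _ => univ_mem, fun _ => measure_lt_top _ _, Set.iUnion_const _⟩
  refine Measure.prod_eq_generateFrom generateFrom_squareCylinders generateFrom_squareCylinders
    pi_sys pi_sys spanning spanning ?_
  rintro _ ⟨s, t, ht, rfl⟩ _ ⟨s', u, hu, rfl⟩
  have enlarge {s S : Finset ℕ} {t : ℕ → Set Ω} (ht : ∀ k, MeasurableSet (t k)) (hs : s ⊆ S) :
      ∃ T : ℕ → Set Ω, (∀ k, MeasurableSet (T k)) ∧ (s : Set ℕ).pi t = (S : Set ℕ).pi T := by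
    refine ⟨fun k => if k ∈ s then t k else Set.univ, fun k => ?_, ?_⟩
    · dsimp only
      split_ifs
      exacts [ht k, .univ]
    ext x
    simp only [Set.mem_pi, Finset.mem_coe]
    refine ⟨fun h k _ => ?_, fun h k hk => by simpa [hk] using h k (hs hk)⟩
    split_ifs with hk
    exacts [h k hk, trivial]
  obtain ⟨S, hi, hsS, hs'S⟩ : ∃ S : Finset ℕ, i ∈ S ∧ s ⊆ S ∧ s' ⊆ S :=
    ⟨insert i (s ∪ s'), by grind, by grind, by grind⟩
  obtain ⟨T, hTm, hT⟩ := enlarge (fun k => ht k trivial) hsS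
  obtain ⟨V, hVm, hV⟩ := enlarge (fun k => hu k trivial) hs'S
  rw [hT, hV]
  have preimage_eq : swapAt i ⁻¹' ((S : Set ℕ).pi T ×ˢ (S : Set ℕ).pi V) =
      (S : Set ℕ).pi (Function.update T i (V i)) ×ˢ
        (S : Set ℕ).pi (Function.update V i (T i)) := by
    ext ⟨x, y⟩
    simp only [swapAt, Set.mem_preimage, Set.mem_prod, Set.mem_pi, Finset.mem_coe,
      Function.update_apply]
    grind
  have update_meas {T : ℕ → Set Ω} (hT : ∀ k, MeasurableSet (T k)) {v : Set Ω}
      (hv : MeasurableSet v) k : MeasurableSet (Function.update T i v k) := by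
    rw [Function.update_apply]
    split_ifs
    exacts [hv, hT k]
  have pi_meas {T : ℕ → Set Ω} (hT : ∀ k, MeasurableSet (T k)) :
      MeasurableSet ((S : Set ℕ).pi T) :=
    .pi S.countable_toSet fun k _ => hT k
  rw [Measure.map_apply (measurable_swapAt i) ((pi_meas hTm).prod (pi_meas hVm)), preimage_eq,
    Measure.prod_prod, hν, Measure.infinitePi_pi _ fun k _ => hTm k,
    Measure.infinitePi_pi _ fun k _ => hVm k,
    Measure.infinitePi_pi _ fun k _ => update_meas hTm (hVm i) k,
    Measure.infinitePi_pi _ fun k _ => update_meas hVm (hTm i) k,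
    ← Finset.prod_mul_distrib, ← Finset.prod_mul_distrib]
  refine Finset.prod_congr rfl fun k _ => ?_
  by_cases hk : k = i
  · subst hk; simp [mul_comm]
  · simp [hk]

lemma eq_infinitePi_of_map_fin {μ : Measure Ω} [IsProbabilityMeasure μ] {ν : Measure (ℕ → Ω)}
    (hν : ∀ n : ℕ, ν.map (fun x (k : Fin n) => x k) = Measure.pi fun _ : Fin n => μ) :
    ν = Measure.infinitePi fun _ => μ := by
  refine Measure.eq_infinitePi _ fun s t ht => ?_
  obtain ⟨n, hn⟩ := s.exists_nat_subset_range
  have hmeas : Measurable fun (x : ℕ → Ω) (k : Fin n) => x k := by fun_prop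
  have hT (k : ℕ) : MeasurableSet (if k ∈ s then t k else Set.univ) := by
    split_ifs
    exacts [ht k, .univ]
  have hpre : (s : Set ℕ).pi t = (fun (x : ℕ → Ω) (k : Fin n) => x k) ⁻¹'
      Set.univ.pi fun k : Fin n => if (k : ℕ) ∈ s then t k else Set.univ := by
    ext x
    simp only [Set.mem_pi, Finset.mem_coe, Set.mem_preimage, Set.mem_univ, true_imp_iff]
    refine ⟨fun h k => ?_, fun h k hk => ?_⟩
    · split_ifs with hk
      exacts [h k hk, trivial]
    · simpa [hk] using h ⟨k, Finset.mem_range.1 (hn hk)⟩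
  rw [hpre, ← Measure.map_apply hmeas (.univ_pi fun k => hT k), hν, Measure.pi_pi,
    Fin.prod_univ_eq_prod_range (fun k => μ (if k ∈ s then t k else Set.univ)) n,
    ← Finset.prod_subset hn]
  · exact Finset.prod_congr rfl fun k hk => by simp [hk]
  · intro k _ hk
    simp [hk]

section SquareFunction

variable {ν : Measure (ℕ → Ω)} [IsProbabilityMeasure ν]

/-- One-parameter decoupling of the square function of `√(g i)`, with a parameter space `Z`. -/
lemma integral_sqrt_sum_decoupled {Z : Type*} [MeasurableSpace Z] {ρ : Measure Z} [SFinite ρ]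
    (hswap : ∀ i, MeasurePreserving (swapAt i) (ν.prod ν) (ν.prod ν))
    {g : ℕ → (ℕ → Ω) × Z → ℝ} (g_nonneg : ∀ i p, 0 ≤ g i p) (g_meas : ∀ i, Measurable (g i))
    (g_int : ∀ i, Integrable (fun p => √(g i p)) (ν.prod ρ))
    (g_adapted : ∀ i x x' z, (∀ k ≤ i, x k = x' k) → g i (x, z) = g i (x', z)) (N : ℕ) :
    ∫ p, √(∑ i ∈ Finset.range N, g i p) ∂(ν.prod ρ) ≤
      2 * ∫ q, √(∑ i ∈ Finset.range N, g i ((swapAt i q.1).1, q.2)) ∂((ν.prod ν).prod ρ) ∧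
    ∫ q, √(∑ i ∈ Finset.range N, g i ((swapAt i q.1).1, q.2)) ∂((ν.prod ν).prod ρ) ≤
      2 * ∫ p, √(∑ i ∈ Finset.range N, g i p) ∂(ν.prod ρ) := by
  have hfst : MeasurePreserving
      (fun q : ((ℕ → Ω) × (ℕ → Ω)) × Z => (q.1.1, q.2)) ((ν.prod ν).prod ρ) (ν.prod ρ) :=
    measurePreserving_fst.prod (.id ρ)
  have hσ i : MeasurePreserving
      (fun q : ((ℕ → Ω) × (ℕ → Ω)) × Z => (swapAt i q.1, q.2))
      ((ν.prod ν).prod ρ) ((ν.prod ν).prod ρ) :=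
    (hswap i).prod (.id ρ)
  have hlift : ∫ p, √(∑ i ∈ Finset.range N, g i p) ∂(ν.prod ρ) =
      ∫ q, √(∑ i ∈ Finset.range N, g i (q.1.1, q.2)) ∂((ν.prod ν).prod ρ) := by
    rw [← hfst.map_eq, integral_map hfst.measurable.aemeasurable
      (Finset.measurable_sum _ fun i _ => g_meas i).sqrt.aestronglyMeasurable]
  have swap_swap i (p : (ℕ → Ω) × (ℕ → Ω)) : swapAt i (swapAt i p) = p := by
    simp [swapAt]
  have a_int i := hfst.integrable_comp_of_integrable (g_int i)
  have b_int i := (hfst.comp (hσ i)).integrable_comp_of_integrable (g_int i)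
  have a_meas i := (g_meas i).comp hfst.measurable
  have b_meas i := (g_meas i).comp (hfst.comp (hσ i)).measurable
  rw [hlift]
  constructor
  · refine integral_sqrt_sum_le (fun i _ => g_nonneg i _) (fun i _ => g_nonneg i _) a_meas b_meas
      a_int b_int hσ (fun _ _ => rfl) (fun i k hk q => g_adapted k _ _ _ fun l hl => ?_) N
    simp only [swapAt, Function.update_apply]
    grind
  · refine integral_sqrt_sum_le (fun i _ => g_nonneg i _) (fun i _ => g_nonneg i _) b_meas a_meas
      b_int a_int hσ (fun i q => by simp only [Function.comp_apply, swap_swap])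
      (fun i k hk q => g_adapted k _ _ _ fun l hl => ?_) N
    simp only [swapAt, Function.update_apply]
    grind

/-- Two-parameter decoupling over finitely many indices. -/
lemma integral_sqrt_sum_sum_decoupled
    (hswap : ∀ i, MeasurePreserving (swapAt i) (ν.prod ν) (ν.prod ν))
    {f : ℕ → ℕ → (ℕ → Ω) × (ℕ → Ω) → ℝ} (f_meas : ∀ i j, Measurable (f i j))
    (f_int : ∀ i j, Integrable (f i j) (ν.prod ν))
    (f_adapted : ∀ i j x x' y y', (∀ k ≤ i, x k = x' k) → (∀ k ≤ j, y k = y' k) →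
      f i j (x, y) = f i j (x', y')) (N : ℕ) :
    ∫ p, √(∑ i ∈ Finset.range N, ∑ j ∈ Finset.range N, f i j p ^ 2) ∂(ν.prod ν) ≤
      4 * ∫ q, √(∑ i ∈ Finset.range N, ∑ j ∈ Finset.range N,
        f i j ((swapAt i q.2).1, (swapAt j q.1).1) ^ 2) ∂((ν.prod ν).prod (ν.prod ν)) ∧
    ∫ q, √(∑ i ∈ Finset.range N, ∑ j ∈ Finset.range N,
        f i j ((swapAt i q.2).1, (swapAt j q.1).1) ^ 2) ∂((ν.prod ν).prod (ν.prod ν)) ≤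
      4 * ∫ p, √(∑ i ∈ Finset.range N, ∑ j ∈ Finset.range N, f i j p ^ 2) ∂(ν.prod ν) := by
  have hmap i : MeasurePreserving
      (fun p : (ℕ → Ω) × ((ℕ → Ω) × (ℕ → Ω)) => ((swapAt i p.2).1, p.1))
      (ν.prod (ν.prod ν)) (ν.prod ν) :=
    ((measurePreserving_fst.comp (hswap i)).prod (.id ν)).comp Measure.measurePreserving_swap
  have first := integral_sqrt_sum_decoupled (ρ := ν) hswap
    (g := fun i p => ∑ j ∈ Finset.range N, f i j p ^ 2)
    (fun i p => Finset.sum_nonneg fun j _ => sq_nonneg _)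
    (fun i => Finset.measurable_sum _ fun j _ => (f_meas i j).pow_const 2)
    (fun i => integrable_sqrt_sum (fun j p => sq_nonneg _) (fun j => (f_meas i j).pow_const 2)
      (fun j => by simpa only [Real.sqrt_sq_eq_abs] using (f_int i j).abs) _)
    (fun i x x' y h => Finset.sum_congr rfl fun j _ => by
      rw [f_adapted i j x x' y y h fun _ _ => rfl]) N
  have second := integral_sqrt_sum_decoupled (ρ := ν.prod ν) hswap
    (g := fun j p => ∑ i ∈ Finset.range N, f i j ((swapAt i p.2).1, p.1) ^ 2)
    (fun j p => Finset.sum_nonneg fun i _ => sq_nonneg _)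
    (fun j => Finset.measurable_sum _ fun i _ =>
      ((f_meas i j).comp (hmap i).measurable).pow_const 2)
    (fun j => integrable_sqrt_sum (fun i p => sq_nonneg _)
      (fun i => ((f_meas i j).comp (hmap i).measurable).pow_const 2)
      (fun i => by
        simpa only [Real.sqrt_sq_eq_abs] using
          ((hmap i).integrable_comp_of_integrable (f_int i j)).abs) _)
    (fun j y y' z h => Finset.sum_congr rfl fun i _ => by
      rw [f_adapted i j _ _ y y' (fun _ _ => rfl) h]) N
  have hcomm : ∫ q, √(∑ i ∈ Finset.range N, ∑ j ∈ Finset.range N,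
        f i j ((swapAt i q.1).1, q.2) ^ 2) ∂((ν.prod ν).prod ν) =
      ∫ p, √(∑ j ∈ Finset.range N, ∑ i ∈ Finset.range N,
        f i j ((swapAt i p.2).1, p.1) ^ 2) ∂(ν.prod (ν.prod ν)) := by
    rw [← integral_prod_swap]
    exact integral_congr_ae (.of_forall fun p => congrArg _ Finset.sum_comm)
  have hcomm' : ∫ q, √(∑ i ∈ Finset.range N, ∑ j ∈ Finset.range N,
        f i j ((swapAt i q.2).1, (swapAt j q.1).1) ^ 2) ∂((ν.prod ν).prod (ν.prod ν)) =
      ∫ q, √(∑ j ∈ Finset.range N, ∑ i ∈ Finset.range N,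
        f i j ((swapAt i q.2).1, (swapAt j q.1).1) ^ 2) ∂((ν.prod ν).prod (ν.prod ν)) :=
    integral_congr_ae (.of_forall fun q => congrArg _ Finset.sum_comm)
  rw [hcomm] at first
  rw [hcomm']
  constructor
  · linarith [first.1, second.1]
  · linarith [first.2, second.2]

lemma integrable_sqrt_sum_sum_decoupled
    (hswap : ∀ i, MeasurePreserving (swapAt i) (ν.prod ν) (ν.prod ν))
    {f : ℕ → ℕ → (ℕ → Ω) × (ℕ → Ω) → ℝ} (f_meas : ∀ i j, Measurable (f i j))
    (f_int : ∀ i j, Integrable (f i j) (ν.prod ν)) (N : ℕ) :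
    Integrable (fun q => √(∑ i ∈ Finset.range N, ∑ j ∈ Finset.range N,
      f i j ((swapAt i q.2).1, (swapAt j q.1).1) ^ 2)) ((ν.prod ν).prod (ν.prod ν)) := by
  have hmap i j : MeasurePreserving
      (fun q : ((ℕ → Ω) × (ℕ → Ω)) × ((ℕ → Ω) × (ℕ → Ω)) => ((swapAt i q.2).1, (swapAt j q.1).1))
      ((ν.prod ν).prod (ν.prod ν)) (ν.prod ν) :=
    ((measurePreserving_fst.comp (hswap i)).prod (measurePreserving_fst.comp (hswap j))).comp
      Measure.measurePreserving_swap
  have hmeas i j := ((f_meas i j).comp (hmap i j).measurable).pow_const 2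
  refine integrable_sqrt_sum (fun i q => Finset.sum_nonneg fun j _ => sq_nonneg _)
    (fun i => Finset.measurable_sum _ fun j _ => hmeas i j) (fun i => ?_) _
  refine integrable_sqrt_sum (fun j q => sq_nonneg _) (fun j => hmeas i j) (fun j => ?_) _
  simpa only [Real.sqrt_sq_eq_abs] using ((hmap i j).integrable_comp_of_integrable (f_int i j)).abs

end SquareFunction

lemma measurePreserving_reorder {α : Type*} [MeasurableSpace α] (ν : Measure α) [SFinite ν] :
    MeasurePreserving (fun q : (α × α) × (α × α) => ((q.1.2, q.2.2), (q.1.1, q.2.1)))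
      ((ν.prod ν).prod (ν.prod ν)) ((ν.prod ν).prod (ν.prod ν)) := by
  have middle : MeasurePreserving (fun q : α × (α × α) => (q.2.1, (q.1, q.2.2)))
      (ν.prod (ν.prod ν)) (ν.prod (ν.prod ν)) :=
    ((measurePreserving_prodAssoc ν ν ν).comp
      (Measure.measurePreserving_swap.prod (.id ν))).comp
      ((measurePreserving_prodAssoc ν ν ν).symm _)
  exact Measure.measurePreserving_swap.comp
    ((((measurePreserving_prodAssoc ν ν (ν.prod ν)).symm _).comp
      ((MeasurePreserving.id ν).prod middle)).comp (measurePreserving_prodAssoc ν ν (ν.prod ν)))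

/-- Iterated integrals of a function which is integrable for the fourfold product. -/
lemma integral_integral_integral_integral {α : Type*} [MeasurableSpace α] {ν : Measure α}
    [SFinite ν] {G : (α × α) × (α × α) → ℝ}
    (hG : Integrable G ((ν.prod ν).prod (ν.prod ν))) :
    ∫ x, ∫ y, ∫ η, ∫ θ, G ((x, y), (η, θ)) ∂ν ∂ν ∂ν ∂ν =
      ∫ q, G q ∂((ν.prod ν).prod (ν.prod ν)) := by
  have h : (fun p : α × α => ∫ η, ∫ θ, G (p, (η, θ)) ∂ν ∂ν) =ᵐ[ν.prod ν]
      fun p => ∫ r, G (p, r) ∂(ν.prod ν) := by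
    filter_upwards [hG.prod_right_ae] with p hp
    exact (integral_prod _ hp).symm
  rw [integral_prod _ hG, ← integral_congr_ae h,
    integral_prod _ (hG.integral_prod_left.congr h.symm)]

lemma measurable_of_canonF2 {Ω : Type} [MeasurableSpace Ω] {i j : ℕ}
    {f : (ℕ → Ω) × (ℕ → Ω) → ℝ} (hf : Measurable[canonF2 Ω i j] f) : Measurable f := by
  have h (i : ℕ) : canonF Ω i ≤ MeasurableSpace.pi :=
    Measurable.comap_le (measurable_pi_lambda _ fun k => measurable_pi_apply (k : ℕ))
  exact hf.mono (sup_le_sup (MeasurableSpace.comap_mono (h i))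
    (MeasurableSpace.comap_mono (h j))) le_rfl

lemma eq_of_measurable_canonF2 {Ω : Type} [MeasurableSpace Ω] {i j : ℕ}
    {f : (ℕ → Ω) × (ℕ → Ω) → ℝ} (hf : Measurable[canonF2 Ω i j] f) {x x' y y' : ℕ → Ω}
    (hx : ∀ k ≤ i, x k = x' k) (hy : ∀ k ≤ j, y k = y' k) : f (x, y) = f (x', y') := by
  have hcomap : canonF2 Ω i j = MeasurableSpace.comap
      (fun p : (ℕ → Ω) × (ℕ → Ω) =>
        ((fun k : Fin (i + 1) => p.1 k), (fun k : Fin (j + 1) => p.2 k))) inferInstance := by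
    refine Eq.trans ?_ (MeasurableSpace.comap_prodMk _ _).symm
    rw [canonF2, canonF, canonF, MeasurableSpace.prod, MeasurableSpace.comap_comp,
      MeasurableSpace.comap_comp]
    rfl
  rw [hcomap] at hf
  refine hf.factorsThrough ?_
  ext k
  · exact hx k (Nat.lt_succ_iff.1 k.2)
  · exact hy k (Nat.lt_succ_iff.1 k.2)

lemma exists_tsum_eq_sum_range {X : Type*} {f : ℕ × ℕ → X → ℝ}
    (hf : (Function.support f).Finite) :
    ∃ N, ∀ u : ℕ × ℕ → X, ∑' p, f p (u p) ^ 2 =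
      ∑ i ∈ Finset.range N, ∑ j ∈ Finset.range N, f (i, j) (u (i, j)) ^ 2 := by
  obtain ⟨N, hN⟩ := (hf.toFinset.image Prod.fst ∪ hf.toFinset.image Prod.snd).exists_nat_subset_range
  refine ⟨N, fun u => ?_⟩
  rw [← Finset.sum_product', tsum_eq_sum]
  intro p hp
  by_contra hne
  refine hp ?_
  have hmem : p ∈ hf.toFinset := by
    rw [Set.Finite.mem_toFinset, Function.mem_support]
    rintro h
    simp [h] at hne
  exact Finset.mem_product.2
    ⟨hN (Finset.mem_union_left _ (Finset.mem_image_of_mem _ hmem)),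
      hN (Finset.mem_union_right _ (Finset.mem_image_of_mem _ hmem))⟩

end Decoupling

/-- two-parameter decoupling: for a finitely supported family adapted to
the canonical two-parameter product filtration, the `L¹` norm of the square function is
equivalent, with absolute constants, to the decoupled one in which the last coordinates
`x_i`, `y_j` are replaced by coordinates of independent copies `η`, `θ`. -/
theorem statement5 :
    ∃ c C : ℝ, 0 < c ∧ 0 < C ∧
      ∀ (Ω : Type) [MeasurableSpace Ω] (μ : Measure Ω), IsProbabilityMeasure μ →
        ∀ (ν : Measure (ℕ → Ω)), IsProbabilityMeasure ν →
          (∀ n : ℕ, ν.map (fun x (k : Fin n) => x k) = Measure.pi fun _ : Fin n => μ) →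
          ∀ f : ℕ × ℕ → (ℕ → Ω) × (ℕ → Ω) → ℝ,
            (∀ i j : ℕ, Measurable[canonF2 Ω i j] (f (i, j))) →
            (∀ p : ℕ × ℕ, Integrable (f p) (ν.prod ν)) →
            (Function.support f).Finite →
            c * (∫ x, ∫ y, ∫ η, ∫ θ, Real.sqrt (∑' p : ℕ × ℕ,
                  (f p (Function.update x p.1 (η p.1), Function.update y p.2 (θ p.2))) ^ 2)
                  ∂ν ∂ν ∂ν ∂ν) ≤
              (∫ x, ∫ y, Real.sqrt (∑' p : ℕ × ℕ, (f p (x, y)) ^ 2) ∂ν ∂ν) ∧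
            (∫ x, ∫ y, Real.sqrt (∑' p : ℕ × ℕ, (f p (x, y)) ^ 2) ∂ν ∂ν) ≤
              C * (∫ x, ∫ y, ∫ η, ∫ θ, Real.sqrt (∑' p : ℕ × ℕ,
                  (f p (Function.update x p.1 (η p.1), Function.update y p.2 (θ p.2))) ^ 2)
                  ∂ν ∂ν ∂ν ∂ν) := by
  refine ⟨1 / 4, 4, by norm_num, by norm_num, ?_⟩
  intro Ω _ μ hμ ν hν hmap f hf hint hsupp
  have hswap i : MeasurePreserving (Decoupling.swapAt i) (ν.prod ν) (ν.prod ν) := by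
    rw [Decoupling.eq_infinitePi_of_map_fin hmap]
    exact Decoupling.measurePreserving_swapAt μ i
  have f_meas i j : Measurable (f (i, j)) := Decoupling.measurable_of_canonF2 (hf i j)
  have f_int i j := hint (i, j)
  obtain ⟨N, hN⟩ := Decoupling.exists_tsum_eq_sum_range hsupp
  have hdec := Decoupling.integral_sqrt_sum_sum_decoupled hswap f_meas f_int
    (fun i j _ _ _ _ hx hy => Decoupling.eq_of_measurable_canonF2 (hf i j) hx hy) N
  have hreorder := Decoupling.measurePreserving_reorder ν
  have hG := Decoupling.integrable_sqrt_sum_sum_decoupled hswap f_meas f_int N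
  have hright := Decoupling.integral_integral_integral_integral
    (hreorder.integrable_comp_of_integrable hG)
  have hchange := integral_map hreorder.measurable.aemeasurable
    (hreorder.map_eq.symm ▸ hG.aestronglyMeasurable)
  rw [hreorder.map_eq] at hchange
  have hleft := integral_prod _ (Decoupling.integrable_sqrt_sum
    (m := ν.prod ν) (s := Finset.range N)
    (a := fun i p => ∑ j ∈ Finset.range N, f (i, j) p ^ 2)
    (fun i p => Finset.sum_nonneg fun j _ => sq_nonneg _)
    (fun i => Finset.measurable_sum _ fun j _ => (f_meas i j).pow_const 2)
    (fun i => Decoupling.integrable_sqrt_sum (fun j p => sq_nonneg _)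
      (fun j => (f_meas i j).pow_const 2)
      (fun j => by simpa only [Real.sqrt_sq_eq_abs] using (f_int i j).abs) _))
  have hL : ∫ x, ∫ y, Real.sqrt (∑' p : ℕ × ℕ, (f p (x, y)) ^ 2) ∂ν ∂ν =
      ∫ p, √(∑ i ∈ Finset.range N, ∑ j ∈ Finset.range N, f (i, j) p ^ 2) ∂(ν.prod ν) := by
    rw [hleft]
    simp only [fun x y => hN fun _ => (x, y)]
  have hR : ∫ x, ∫ y, ∫ η, ∫ θ, Real.sqrt (∑' p : ℕ × ℕ,
        (f p (Function.update x p.1 (η p.1), Function.update y p.2 (θ p.2))) ^ 2)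
        ∂ν ∂ν ∂ν ∂ν =
      ∫ q, √(∑ i ∈ Finset.range N, ∑ j ∈ Finset.range N,
        f (i, j) ((Decoupling.swapAt i q.2).1, (Decoupling.swapAt j q.1).1) ^ 2)
        ∂((ν.prod ν).prod (ν.prod ν)) := by
    rw [hchange]
    refine Eq.trans ?_ hright
    simp only [fun x y η θ : ℕ → Ω => hN fun p =>
      (Function.update x p.1 (η p.1), Function.update y p.2 (θ p.2))]
    rfl
  rw [hL, hR]
  constructor
  · linarith [hdec.2]
  · exact hdec.1

end
end

section
/- (Zinn's decoupling inequality.) Let (Ω,𝓕,μ) be a probability space and let (f_k)_{k≥0} be functions adapted to the canonical product filtration on Ω^ℕ, i.e. f_k depends only on (x_0,…,x_k), with only finitely many f_k nonzero. Then, with absolute implied constants, ∫_{Ω^ℕ} (Σ_k f_k(x_0,…,x_k)²)^{1/2} dx ≃ ∫_{Ω^ℕ} ∫_{Ω^ℕ} (Σ_k f_k(x_0,…,x_{k−1},η_k)²)^{1/2} dx dη, where η is an independent copy of x. -/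
open MeasureTheory

noncomputable section

/-- Increments of the square root decrease in the base point. -/
lemma sqrt_add_sub_sqrt_anti {t u b : ℝ} (ht : 0 ≤ t) (htu : t ≤ u) (hb : 0 ≤ b) :
    √(u + b) + √t ≤ √(t + b) + √u := by
  have h1 : √t ≤ √u := Real.sqrt_le_sqrt htu
  have h2 : √(t + b) ≤ √(u + b) := Real.sqrt_le_sqrt (by linarith)
  have h3 : √u ≤ √(u + b) := Real.sqrt_le_sqrt (by linarith)
  have h4 : √t ≤ √(t + b) := Real.sqrt_le_sqrt (by linarith)
  have e1 := Real.sq_sqrt ht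
  have e2 := Real.sq_sqrt (ht.trans htu)
  have e3 := Real.sq_sqrt (add_nonneg ht hb)
  have e4 := Real.sq_sqrt (add_nonneg (ht.trans htu) hb)
  have := Real.sqrt_nonneg t
  by_contra! h
  nlinarith [mul_nonneg (sub_nonneg.2 h3) (sub_nonneg.2 h1),
    mul_nonneg (sub_nonneg.2 h4) (sub_nonneg.2 h1)]

lemma integrable_sqrt_add {α : Type*} [MeasurableSpace α] {P : Measure α} {u v : α → ℝ}
    (hu : Measurable u) (hv : Measurable v) (hu0 : 0 ≤ u) (hv0 : 0 ≤ v)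
    (hui : Integrable (fun p => √(u p)) P) (hvi : Integrable (fun p => √(v p)) P) :
    Integrable (fun p => √(u p + v p)) P := by
  refine (hui.add hvi).mono' (by fun_prop) (.of_forall fun p => ?_)
  rw [Real.norm_of_nonneg (Real.sqrt_nonneg _)]
  simpa [add_comm] using sqrt_add_sub_sqrt_anti le_rfl (hu0 p) (hv0 p)

lemma integrable_sqrt_sum {α : Type*} [MeasurableSpace α] {P : Measure α} {a : ℕ → α → ℝ}
    (ha : ∀ k, Measurable (a k)) (ha0 : ∀ k, 0 ≤ a k)
    (hai : ∀ k, Integrable (fun p => √(a k p)) P) (s : Finset ℕ) :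
    Integrable (fun p => √(∑ j ∈ s, a j p)) P := by
  induction s using Finset.cons_induction with
  | empty => simp
  | cons i s hi ih =>
    simp only [Finset.sum_cons]
    exact integrable_sqrt_add (ha i) (by fun_prop) (ha0 i)
      (fun p => Finset.sum_nonneg fun j _ => ha0 j p) (hai i) ih

/-- Comparison of square functions of two sequences that may be exchanged one index at a time,
in the presence of the past of both. -/
lemma integral_sqrt_sum_le_two_mul {α : Type*} [MeasurableSpace α] {P : Measure α}
    {a b : ℕ → α → ℝ}
    (ha : ∀ k, Measurable (a k)) (ha0 : ∀ k, 0 ≤ a k)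
    (hai : ∀ k, Integrable (fun p => √(a k p)) P)
    (hb : ∀ k, Measurable (b k)) (hb0 : ∀ k, 0 ≤ b k)
    (hbi : ∀ k, Integrable (fun p => √(b k p)) P)
    (hab : ∀ k, ∫ p, √(∑ j ∈ Finset.range k, (a j p + b j p) + a k p) ∂P =
      ∫ p, √(∑ j ∈ Finset.range k, (a j p + b j p) + b k p) ∂P) (n : ℕ) :
    ∫ p, √(∑ j ∈ Finset.range n, a j p) ∂P ≤ 2 * ∫ p, √(∑ j ∈ Finset.range n, b j p) ∂P := by
  have hc0 (k : ℕ) : 0 ≤ fun p => a k p + b k p := fun p => add_nonneg (ha0 k p) (hb0 k p)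
  have hc (k : ℕ) : Measurable fun p => a k p + b k p := (ha k).add (hb k)
  have hU0 (n : ℕ) : 0 ≤ fun p => ∑ j ∈ Finset.range n, (a j p + b j p) :=
    fun p => Finset.sum_nonneg fun j _ => hc0 j p
  have hU (n : ℕ) : Measurable fun p => ∑ j ∈ Finset.range n, (a j p + b j p) := by fun_prop
  have hUi (n : ℕ) : Integrable (fun p => √(∑ j ∈ Finset.range n, (a j p + b j p))) P :=
    integrable_sqrt_sum hc hc0
      (fun k => integrable_sqrt_add (ha k) (hb k) (ha0 k) (hb0 k) (hai k) (hbi k)) _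
  have hTi (n : ℕ) := integrable_sqrt_sum hb hb0 hbi (Finset.range n)
  have key : ∫ p, √(∑ j ∈ Finset.range n, (a j p + b j p)) ∂P ≤
      2 * ∫ p, √(∑ j ∈ Finset.range n, b j p) ∂P := by
    induction n with
    | zero => simp
    | succ n ih =>
      have hUa := integrable_sqrt_add (hU n) (ha n) (hU0 n) (ha0 n) (hUi n) (hai n)
      have hUb := integrable_sqrt_add (hU n) (hb n) (hU0 n) (hb0 n) (hUi n) (hbi n)
      have h1 : ∫ p, (√(∑ j ∈ Finset.range (n + 1), (a j p + b j p)) +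
            √(∑ j ∈ Finset.range n, (a j p + b j p))) ∂P ≤
          ∫ p, (√(∑ j ∈ Finset.range n, (a j p + b j p) + a n p) +
            √(∑ j ∈ Finset.range n, (a j p + b j p) + b n p)) ∂P := by
        refine integral_mono ((hUi _).add (hUi n)) (hUa.add hUb) fun p => ?_
        have := sqrt_add_sub_sqrt_anti (hU0 n p) (le_add_of_nonneg_right (ha0 n p)) (hb0 n p)
        simp only [Finset.sum_range_succ, ← add_assoc]
        linarith
      have h2 : ∫ p, (√(∑ j ∈ Finset.range n, (a j p + b j p) + b n p) +
            √(∑ j ∈ Finset.range n, b j p)) ∂P ≤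
          ∫ p, (√(∑ j ∈ Finset.range (n + 1), b j p) +
            √(∑ j ∈ Finset.range n, (a j p + b j p))) ∂P := by
        refine integral_mono (hUb.add (hTi n)) ((hTi _).add (hUi n)) fun p => ?_
        have := sqrt_add_sub_sqrt_anti (Finset.sum_nonneg fun j _ => hb0 j p)
          (Finset.sum_le_sum fun j (_ : j ∈ Finset.range n) =>
            le_add_of_nonneg_left (a := b j p) (ha0 j p)) (hb0 n p)
        simpa only [Finset.sum_range_succ] using this
      rw [integral_add (hUi _) (hUi n), integral_add hUa hUb, hab n] at h1
      rw [integral_add hUb (hTi n), integral_add (hTi _) (hUi n)] at h2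
      linarith
  refine le_trans (integral_mono (integrable_sqrt_sum ha ha0 hai _) (hUi n) fun p => ?_) key
  exact Real.sqrt_le_sqrt (Finset.sum_le_sum fun j _ => le_add_of_nonneg_right (hb0 j p))

lemma eq_infinitePi_of_map_fin {Ω : Type*} [MeasurableSpace Ω] {μ : Measure Ω}
    [IsProbabilityMeasure μ] {ν : Measure (ℕ → Ω)}
    (hν : ∀ n : ℕ, ν.map (fun x (k : Fin n) => x k) = Measure.pi fun _ : Fin n => μ) :
    ν = Measure.infinitePi fun _ => μ := by
  refine Measure.eq_infinitePi _ fun s t ht => ?_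
  classical
  obtain ⟨n, hn⟩ := s.exists_nat_subset_range
  let t' : ℕ → Set Ω := fun i => if i ∈ s then t i else Set.univ
  have ht' (i : ℕ) : MeasurableSet (t' i) := by
    by_cases h : i ∈ s <;> simp [t', h, ht]
  have hpre : Set.pi s t = (fun x (k : Fin n) => x k) ⁻¹' Set.univ.pi fun k : Fin n => t' k := by
    ext x
    simp only [Set.mem_pi, Finset.mem_coe, Set.mem_preimage, Set.mem_univ, forall_const]
    refine ⟨fun h k => ?_, fun h i hi => ?_⟩
    · by_cases hk : (k : ℕ) ∈ s <;> simp [t', hk, h]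
    · simpa [t', hi] using h ⟨i, Finset.mem_range.1 (hn hi)⟩
  rw [hpre, ← Measure.map_apply (by fun_prop) (.univ_pi fun k : Fin n => ht' k), hν, Measure.pi_pi,
    Fin.prod_univ_eq_prod_range (fun i => μ (t' i)) n]
  rw [← Finset.prod_subset hn fun i _ hi => by simp [t', hi]]
  exact Finset.prod_congr rfl fun i hi => by simp [t', hi]

lemma measurePreserving_update_infinitePi {ι Ω : Type*} [DecidableEq ι] [MeasurableSpace Ω]
    (μ : Measure Ω) [IsProbabilityMeasure μ] (k : ι) :
    MeasurePreserving (fun p : Ω × (ι → Ω) => Function.update p.2 k p.1)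
      (μ.prod (Measure.infinitePi fun _ => μ)) (Measure.infinitePi fun _ => μ) := by
  have hm : Measurable fun p : Ω × (ι → Ω) => Function.update p.2 k p.1 := by
    refine measurable_pi_lambda _ fun i => ?_
    rcases eq_or_ne i k with rfl | h
    · simpa using measurable_fst
    · simp only [Function.update_of_ne h]; fun_prop
  refine ⟨hm, Measure.eq_infinitePi _ fun s t ht => ?_⟩
  rw [Measure.map_apply hm (.pi s.countable_toSet fun i _ => ht i)]
  by_cases hk : k ∈ s
  · have : (fun p : Ω × (ι → Ω) => Function.update p.2 k p.1) ⁻¹' Set.pi s t =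
        t k ×ˢ Set.pi (s.erase k : Finset ι) t := by
      ext ⟨w, x⟩
      simp only [Set.mem_preimage, Set.mem_pi, Finset.mem_coe, Set.mem_prod, Finset.mem_erase]
      refine ⟨fun h => ⟨by simpa using h k hk, fun i hi => by simpa [hi.1] using h i hi.2⟩,
        fun h i hi => ?_⟩
      rcases eq_or_ne i k with rfl | hik
      · simpa using h.1
      · simpa [hik] using h.2 i ⟨hik, hi⟩
    rw [this, Measure.prod_prod, Measure.infinitePi_pi _ fun i _ => ht i,
      Finset.mul_prod_erase s (fun i => μ (t i)) hk]
  · have : (fun p : Ω × (ι → Ω) => Function.update p.2 k p.1) ⁻¹' Set.pi s t =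
        Set.univ ×ˢ Set.pi s t := by
      ext ⟨w, x⟩
      simp only [Set.mem_preimage, Set.mem_pi, Finset.mem_coe, Set.mem_prod, Set.mem_univ,
        true_and]
      refine forall₂_congr fun i hi => ?_
      rw [Function.update_of_ne (ne_of_mem_of_not_mem hi hk)]
    rw [this, Measure.prod_prod, Measure.infinitePi_pi _ fun i _ => ht i, measure_univ, one_mul]

lemma measurePreserving_prodProdProdComm {A B C D : Type*} [MeasurableSpace A] [MeasurableSpace B]
    [MeasurableSpace C] [MeasurableSpace D] (α : Measure A) (β : Measure B) (γ : Measure C)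
    (δ : Measure D) [SFinite α] [SFinite β] [SFinite γ] [SFinite δ] :
    MeasurePreserving (fun p : (A × B) × C × D => ((p.1.1, p.2.1), (p.1.2, p.2.2)))
      ((α.prod β).prod (γ.prod δ)) ((α.prod γ).prod (β.prod δ)) := by
  have h1 := measurePreserving_prodAssoc α β (γ.prod δ)
  have h2 := (measurePreserving_prodAssoc β γ δ).symm
  have h3 := (Measure.measurePreserving_swap (μ := β) (ν := γ)).prod (.id δ)
  have h4 := measurePreserving_prodAssoc γ β δ
  have h5 := (measurePreserving_prodAssoc α γ (β.prod δ)).symm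
  exact h5.comp (((MeasurePreserving.id α).prod (h4.comp (h3.comp h2))).comp h1)

/-- Exchanging one coordinate between two independent copies preserves their joint law. -/
lemma measurePreserving_exchange_infinitePi {ι Ω : Type*} [DecidableEq ι] [MeasurableSpace Ω]
    (μ : Measure Ω) [IsProbabilityMeasure μ] (k : ι) :
    MeasurePreserving
      (fun p : (ι → Ω) × (ι → Ω) =>
        (Function.update p.1 k (p.2 k), Function.update p.2 k (p.1 k)))
      ((Measure.infinitePi fun _ => μ).prod (Measure.infinitePi fun _ => μ))
      ((Measure.infinitePi fun _ => μ).prod (Measure.infinitePi fun _ => μ)) := by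
  set ν : Measure (ι → Ω) := Measure.infinitePi fun _ => μ
  have hT : MeasurePreserving (fun p : Ω × (ι → Ω) => Function.update p.2 k p.1) (μ.prod ν) ν :=
    measurePreserving_update_infinitePi μ k
  have hTT := hT.prod hT
  have hS := (measurePreserving_prodProdProdComm μ μ ν ν).comp
    (((Measure.measurePreserving_swap (μ := μ) (ν := μ)).prod (.id (ν.prod ν))).comp
      (measurePreserving_prodProdProdComm μ ν μ ν))
  have hm : Measurable fun p : (ι → Ω) × (ι → Ω) =>
      (Function.update p.1 k (p.2 k), Function.update p.2 k (p.1 k)) := by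
    have hu : Measurable fun p : (ι → Ω) × (ι → Ω) => Function.update p.1 k (p.2 k) :=
      hT.measurable.comp (f := fun p : (ι → Ω) × (ι → Ω) => (p.2 k, p.1)) (by fun_prop)
    exact hu.prodMk (hu.comp measurable_swap)
  refine ⟨hm, ?_⟩
  conv_lhs => rw [← hTT.map_eq]
  rw [Measure.map_map hm hTT.measurable]
  convert (hTT.comp hS).map_eq using 2
  ext p <;> simp [Prod.map]

lemma eq_of_measurable_canonF {Ω : Type} [MeasurableSpace Ω] {k : ℕ} {g : (ℕ → Ω) → ℝ}
    (hg : Measurable[canonF Ω k] g) {x y : ℕ → Ω} (h : ∀ i ≤ k, x i = y i) : g x = g y := by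
  refine hg.factorsThrough (funext fun i : Fin (k + 1) => h i (Nat.lt_succ_iff.1 i.2))

/-- Zinn's decoupling inequality: for a finitely supported sequence
adapted to the canonical product filtration on `Ω^ℕ`, the `L¹` norm of the square
function is equivalent, with absolute constants, to the decoupled one in which the last
coordinate `x_k` is replaced by the coordinate `η_k` of an independent copy `η`. -/
theorem statement6 :
    ∃ c C : ℝ, 0 < c ∧ 0 < C ∧
      ∀ (Ω : Type) [MeasurableSpace Ω] (μ : Measure Ω), IsProbabilityMeasure μ →
        ∀ (ν : Measure (ℕ → Ω)), IsProbabilityMeasure ν →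
          (∀ n : ℕ, ν.map (fun x (k : Fin n) => x k) = Measure.pi fun _ : Fin n => μ) →
          ∀ f : ℕ → (ℕ → Ω) → ℝ,
            (∀ k : ℕ, Measurable[canonF Ω k] (f k)) →
            (∀ k : ℕ, Integrable (f k) ν) →
            (Function.support f).Finite →
            c * (∫ x, ∫ η, Real.sqrt (∑' k : ℕ,
                  (f k (Function.update x k (η k))) ^ 2) ∂ν ∂ν) ≤
              (∫ x, Real.sqrt (∑' k : ℕ, (f k x) ^ 2) ∂ν) ∧
            (∫ x, Real.sqrt (∑' k : ℕ, (f k x) ^ 2) ∂ν) ≤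
              C * (∫ x, ∫ η, Real.sqrt (∑' k : ℕ,
                  (f k (Function.update x k (η k))) ^ 2) ∂ν ∂ν) := by
  refine ⟨1 / 2, 2, by norm_num, by norm_num, ?_⟩
  intro Ω _ μ _ ν _ hν f hf hfi hfin
  obtain rfl := eq_infinitePi_of_map_fin hν
  set ν : Measure (ℕ → Ω) := Measure.infinitePi fun _ => μ
  obtain ⟨N, hN⟩ := hfin.toFinset.exists_nat_subset_range
  have hzero (k : ℕ) (hk : k ∉ Finset.range N) : f k = 0 := by
    by_contra h
    exact hk (hN (hfin.mem_toFinset.2 h))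
  let Φ (k : ℕ) (p : (ℕ → Ω) × (ℕ → Ω)) : (ℕ → Ω) × (ℕ → Ω) :=
    (Function.update p.1 k (p.2 k), Function.update p.2 k (p.1 k))
  have hΦ (k : ℕ) : MeasurePreserving (Φ k) (ν.prod ν) (ν.prod ν) :=
    measurePreserving_exchange_infinitePi μ k
  have hΦΦ (k : ℕ) (p : (ℕ → Ω) × (ℕ → Ω)) : Φ k (Φ k p) = p := by simp [Φ]
  let a (k : ℕ) (p : (ℕ → Ω) × (ℕ → Ω)) : ℝ := f k p.1 ^ 2
  let b (k : ℕ) (p : (ℕ → Ω) × (ℕ → Ω)) : ℝ := f k (Function.update p.1 k (p.2 k)) ^ 2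
  have hfm (k : ℕ) : Measurable (f k) :=
    (hf k).mono (Measurable.comap_le (by fun_prop)) le_rfl
  have ha (k : ℕ) : Measurable (a k) := ((hfm k).comp measurable_fst).pow_const 2
  have hb (k : ℕ) : Measurable (b k) := (ha k).comp (hΦ k).measurable
  have ha0 (k : ℕ) : 0 ≤ a k := fun p => sq_nonneg _
  have hb0 (k : ℕ) : 0 ≤ b k := fun p => sq_nonneg _
  have hai (k : ℕ) : Integrable (fun p => √(a k p)) (ν.prod ν) := by
    simp only [a, Real.sqrt_sq_eq_abs]
    exact ((hfi k).comp_fst ν).abs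
  have hbi (k : ℕ) : Integrable (fun p => √(b k p)) (ν.prod ν) :=
    (hΦ k).integrable_comp_of_integrable (hai k)
  have hab (k : ℕ) : ∫ p, √(∑ j ∈ Finset.range k, (a j p + b j p) + a k p) ∂ν.prod ν =
      ∫ p, √(∑ j ∈ Finset.range k, (a j p + b j p) + b k p) ∂ν.prod ν := by
    have hm : Measurable fun p => √(∑ j ∈ Finset.range k, (a j p + b j p) + a k p) := by fun_prop
    conv_lhs => rw [← (hΦ k).map_eq]
    rw [integral_map (hΦ k).measurable.aemeasurable hm.aestronglyMeasurable]
    refine integral_congr_ae (.of_forall fun p => ?_)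
    have hpast : ∀ j ∈ Finset.range k, a j (Φ k p) + b j (Φ k p) = a j p + b j p := by
      intro j hj
      have hjk : j < k := Finset.mem_range.1 hj
      have h1 : f j (Φ k p).1 = f j p.1 := eq_of_measurable_canonF (hf j) fun i hi => by
        simp [Φ, Function.update_of_ne (hi.trans_lt hjk).ne]
      have h2 : f j (Function.update (Φ k p).1 j ((Φ k p).2 j)) =
          f j (Function.update p.1 j (p.2 j)) := eq_of_measurable_canonF (hf j) fun i hi => by
        rcases eq_or_ne i j with rfl | hij
        · simp [Φ, hjk.ne]
        · simp [Φ, hij, Function.update_of_ne (hi.trans_lt hjk).ne]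
      simp only [a, b, h1, h2]
    change √(_ + b k p) = _
    rw [Finset.sum_congr rfl hpast]
  have hA : ∫ x, √(∑' k : ℕ, f k x ^ 2) ∂ν =
      ∫ p, √(∑ k ∈ Finset.range N, a k p) ∂ν.prod ν := by
    rw [integral_fun_fst (μ := ν) (ν := ν) fun x => √(∑ k ∈ Finset.range N, f k x ^ 2)]
    simp only [probReal_univ, one_smul]
    congr! 3 with x
    exact tsum_eq_sum fun k hk => by simp [hzero k hk]
  have hB : ∫ x, ∫ η, √(∑' k : ℕ, f k (Function.update x k (η k)) ^ 2) ∂ν ∂ν =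
      ∫ p, √(∑ k ∈ Finset.range N, b k p) ∂ν.prod ν := by
    rw [integral_prod _ (integrable_sqrt_sum hb hb0 hbi _)]
    congr! 5 with x η
    exact tsum_eq_sum fun k hk => by simp [hzero k hk]
  rw [hA, hB]
  refine ⟨?_, integral_sqrt_sum_le_two_mul ha ha0 hai hb hb0 hbi hab N⟩
  have := integral_sqrt_sum_le_two_mul hb hb0 hbi ha ha0 hai
    (fun k => by simpa only [add_comm (b _ _) (a _ _)] using (hab k).symm) N
  linarith

end
end

section
/- There is an absolute constant c > 0 with the following property. Let (Ω,𝓕,μ) be a probability space and let (f_{i,j})_{i,j≥0} be functions in L¹(Ω×Ω), only finitely many nonzero. Then there exist {0,1}-valued measurable functions a_{i,j}, b_{i,j}, c_{i,j}, d_{i,j} on Ω×Ω with a_{i,j}+b_{i,j}+c_{i,j}+d_{i,j} = 1 such that ∫_{Ω^ℕ}∫_{Ω^ℕ} (Σ_{i,j} f_{i,j}(x_i,y_j)²)^{1/2} dx dy ≥ c·( Σ_{i,j} ∫_Ω∫_Ω |a_{i,j} f_{i,j}|(x_i,y_j) dx_i dy_j + (Σ_{i,j} ∫_Ω∫_Ω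 (b_{i,j} f_{i,j})²(x_i,y_j) dx_i dy_j)^{1/2} + Σ_i ∫_Ω (Σ_j ∫_Ω (c_{i,j} f_{i,j})(x_i,y_j)² dy_j)^{1/2} dx_i + Σ_j ∫_Ω (Σ_i ∫_Ω (d_{i,j} f_{i,j})(x_i,y_j)² dx_i)^{1/2} dy_j ), where on the left f_{i,j}(x_i,y_j) is evaluated at the i-th coordinate of x ∈ Ω^ℕ and the j-th coordinate of y ∈ Ω^ℕ (independent coordinates), and Ω^ℕ carries the product measure. -/
open MeasureTheory

noncomputable section

/-- The ratio `u / t` truncated at `1`. -/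
def clippedRatio (u t : ENNReal) : ENNReal := min 1 (u / t)

theorem clippedRatio_le_one (u t : ENNReal) : clippedRatio u t ≤ 1 := min_le_left _ _

theorem clippedRatio_antitone (u : ENNReal) : Antitone (clippedRatio u) := fun _ _ h =>
  min_le_min le_rfl (ENNReal.div_le_div_left h u)

theorem continuous_clippedRatio {u : ENNReal} (hu : u ≠ ⊤) : Continuous (clippedRatio u) :=
  continuous_const.min
    (continuous_iff_continuousAt.2 fun _ => ENNReal.Tendsto.const_div Filter.tendsto_id (Or.inr hu))

theorem clippedRatio_top (u : ENNReal) : clippedRatio u ⊤ = 0 := by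
  simp [clippedRatio, ENNReal.div_top]

@[fun_prop]
theorem Measurable.clippedRatio {α : Type*} [MeasurableSpace α] {u t : α → ENNReal}
    (hu : Measurable u) (ht : Measurable t) :
    Measurable fun z => _root_.clippedRatio (u z) (t z) :=
  measurable_const.min (hu.div ht)

theorem mul_clippedRatio_le (u t : ENNReal) : t * clippedRatio u t ≤ u :=
  (mul_le_mul_right (min_le_right _ _) t).trans (ENNReal.mul_div_le)

theorem mul_clippedRatio_eq {u t : ENNReal} (h : u < t) (ht : t ≠ ⊤) :
    t * clippedRatio u t = u := by
  have h0 : t ≠ 0 := (zero_le.trans_lt h).ne'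
  rw [clippedRatio, min_eq_right, ENNReal.mul_div_cancel h0 ht]
  exact ENNReal.div_le_of_le_mul (by simpa using h.le)

theorem mul_clippedRatio_of_le {u t : ENNReal} (h : t ≤ u) (hu : u ≠ ⊤) :
    u * clippedRatio u t = u := by
  rcases eq_or_ne u 0 with rfl | h0
  · simp
  rw [clippedRatio, min_eq_left, mul_one]
  rcases eq_or_ne t 0 with rfl | ht0
  · simp [ENNReal.div_zero h0]
  rw [ENNReal.le_div_iff_mul_le (Or.inl ht0) (Or.inl (h.trans_lt hu.lt_top).ne)]
  simpa using h

section Threshold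

variable {X Y : Type*} [MeasurableSpace X] [MeasurableSpace Y]

/-- The integral of the squared ratio of `G` to `max t w`, truncated at `1`. -/
def clippedEnergy (ν : Measure Y) (G w : Y → ENNReal) (t : ENNReal) : ENNReal :=
  ∫⁻ y, clippedRatio (G y) (max t (w y)) ^ 2 ∂ν

/-- The least level `t` at which the clipped energy is at most `1`. -/
def energyThreshold (ν : Measure Y) (G w : Y → ENNReal) : ENNReal :=
  sInf {t | clippedEnergy ν G w t ≤ 1}

theorem clippedEnergy_antitone (ν : Measure Y) (G w : Y → ENNReal) :
    Antitone (clippedEnergy ν G w) := fun _ _ h =>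
  lintegral_mono fun _ => pow_le_pow_left' (clippedRatio_antitone _ (max_le_max h le_rfl)) 2

theorem energyThreshold_antitone (ν : Measure Y) (G : Y → ENNReal) :
    Antitone (energyThreshold ν G) := fun _ _ h =>
  sInf_le_sInf fun _ ht => le_trans (lintegral_mono fun _ =>
    pow_le_pow_left' (clippedRatio_antitone _ (max_le_max le_rfl (h _))) 2) ht

theorem tendsto_lintegral_clippedRatio_sq {ι : Type*} {l : Filter ι} [l.IsCountablyGenerated]
    (ν : Measure Y) [IsFiniteMeasure ν] {G : Y → ENNReal} (hG : Measurable G)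
    (hG' : ∀ y, G y ≠ ⊤) {v : ι → Y → ENNReal} {v' : Y → ENNReal} (hv : ∀ i, Measurable (v i))
    (h : ∀ y, Filter.Tendsto (fun i => v i y) l (nhds (v' y))) :
    Filter.Tendsto (fun i => ∫⁻ y, clippedRatio (G y) (v i y) ^ 2 ∂ν) l
      (nhds (∫⁻ y, clippedRatio (G y) (v' y) ^ 2 ∂ν)) := by
  refine tendsto_lintegral_filter_of_dominated_convergence (fun _ => 1)
    (.of_forall fun i => ?_) (.of_forall fun i => .of_forall fun y => ?_) (by simp)
    (.of_forall fun y => ?_)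
  · have := hv i
    fun_prop
  · exact pow_le_one' (clippedRatio_le_one _ _) 2
  · exact ENNReal.Tendsto.pow (((continuous_clippedRatio (hG' y)).tendsto _).comp (h y))

variable (ν : Measure Y) [IsFiniteMeasure ν] {G w : Y → ENNReal}

theorem continuous_clippedEnergy (hG : Measurable G) (hG' : ∀ y, G y ≠ ⊤) (hw : Measurable w) :
    Continuous (clippedEnergy ν G w) :=
  continuous_iff_continuousAt.2 fun _ => tendsto_lintegral_clippedRatio_sq ν hG hG'
    (fun _ => measurable_const.max hw)
    fun _ => (continuous_id.max continuous_const).tendsto _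

theorem clippedEnergy_energyThreshold_le (hG : Measurable G) (hG' : ∀ y, G y ≠ ⊤)
    (hw : Measurable w) : clippedEnergy ν G w (energyThreshold ν G w) ≤ 1 := by
  refine IsClosed.sInf_mem (s := {t | clippedEnergy ν G w t ≤ 1}) ⟨⊤, ?_⟩
    (isClosed_le (continuous_clippedEnergy ν hG hG' hw) continuous_const)
  simp [clippedEnergy, clippedRatio_top]

theorem clippedEnergy_energyThreshold_eq (hG : Measurable G) (hG' : ∀ y, G y ≠ ⊤)
    (hw : Measurable w) (h0 : energyThreshold ν G w ≠ 0) :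
    clippedEnergy ν G w (energyThreshold ν G w) = 1 := by
  refine le_antisymm (clippedEnergy_energyThreshold_le ν hG hG' hw) ?_
  have : (nhdsWithin (energyThreshold ν G w) (Set.Iio (energyThreshold ν G w))).NeBot :=
    nhdsLT_neBot_of_exists_lt ⟨0, pos_iff_ne_zero.2 h0⟩
  refine ge_of_tendsto (((continuous_clippedEnergy ν hG hG' hw).tendsto _).mono_left
    (nhdsWithin_le_nhds (s := Set.Iio (energyThreshold ν G w)))) ?_
  filter_upwards [self_mem_nhdsWithin] with t ht
  exact (not_le.1 fun h : clippedEnergy ν G w t ≤ 1 => not_le.2 (Set.mem_Iio.1 ht) (sInf_le h)).le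

theorem energyThreshold_le_iff (hG : Measurable G) (hG' : ∀ y, G y ≠ ⊤) (hw : Measurable w)
    {t : ENNReal} : energyThreshold ν G w ≤ t ↔ clippedEnergy ν G w t ≤ 1 :=
  ⟨fun h => (clippedEnergy_antitone ν G w h).trans (clippedEnergy_energyThreshold_le ν hG hG' hw),
    fun h => sInf_le h⟩

theorem measurable_energyThreshold {F : X × Y → ENNReal} (hF : Measurable F)
    (hF' : ∀ z, F z ≠ ⊤) (hw : Measurable w) :
    Measurable fun x => energyThreshold ν (fun y => F (x, y)) w := by
  refine measurable_of_Iic fun t => ?_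
  have : (fun x => energyThreshold ν (fun y => F (x, y)) w) ⁻¹' Set.Iic t =
      {x | clippedEnergy ν (fun y => F (x, y)) w t ≤ 1} := by
    ext x
    exact energyThreshold_le_iff ν (hF.comp measurable_prodMk_left) (fun y => hF' _) hw
  rw [this]
  refine measurableSet_le ?_ measurable_const
  exact Measurable.lintegral_prod_right'
    (f := fun z : X × Y => clippedRatio (F z) (max t (w z.2)) ^ 2) (by fun_prop)

/-- Row levels `γ` and column levels `δ`, each the energy threshold relative to the other. -/
theorem exists_mutual_energyThreshold (μ : Measure X) [IsFiniteMeasure μ]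
    {F : X × Y → ENNReal} (hF : Measurable F) (hF' : ∀ z, F z ≠ ⊤) :
    ∃ (γ : X → ENNReal) (δ : Y → ENNReal), Measurable γ ∧ Measurable δ ∧
      (∀ x, ∫⁻ y, clippedRatio (F (x, y)) (max (γ x) (δ y)) ^ 2 ∂ν ≤ 1) ∧
      (∀ x, γ x ≠ 0 → ∫⁻ y, clippedRatio (F (x, y)) (max (γ x) (δ y)) ^ 2 ∂ν = 1) ∧
      (∀ y, ∫⁻ x, clippedRatio (F (x, y)) (max (γ x) (δ y)) ^ 2 ∂μ ≤ 1) ∧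
      (∀ y, δ y ≠ 0 → ∫⁻ x, clippedRatio (F (x, y)) (max (γ x) (δ y)) ^ 2 ∂μ = 1) := by
  set Γ : (Y → ENNReal) → X → ENNReal := fun w x => energyThreshold ν (fun y => F (x, y)) w
  set Δ : (X → ENNReal) → Y → ENNReal := fun w y => energyThreshold μ (fun x => F (x, y)) w
  have hΓ : Antitone Γ := fun _ _ h x => energyThreshold_antitone ν _ h
  have hΔ : Antitone Δ := fun _ _ h y => energyThreshold_antitone μ _ h
  have hΓm : ∀ w, Measurable w → Measurable (Γ w) := fun w hw =>
    measurable_energyThreshold ν hF hF' hw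
  have hΔm : ∀ w, Measurable w → Measurable (Δ w) := fun w hw =>
    measurable_energyThreshold μ (F := fun z : Y × X => F z.swap)
      (hF.comp measurable_swap) (fun z => hF' _) hw
  have hFl : ∀ x, Measurable fun y => F (x, y) := fun x => hF.comp measurable_prodMk_left
  have hFr : ∀ y, Measurable fun x => F (x, y) := fun y => hF.comp measurable_prodMk_right
  set g : ℕ → X → ENNReal := fun n => (Γ ∘ Δ)^[n] ⊥
  have hgs : ∀ n, g (n + 1) = Γ (Δ (g n)) := fun n => Function.iterate_succ_apply' _ _ _
  have hg : Monotone g := (hΓ.comp hΔ).monotone_iterate_of_le_map bot_le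
  have hd : Antitone fun n => Δ (g n) := hΔ.comp_monotone hg
  have hgm : ∀ n, Measurable (g n) := by
    intro n
    induction n with
    | zero => exact measurable_const
    | succ n ih => rw [hgs]; exact hΓm _ (hΔm _ ih)
  have hdm : ∀ n, Measurable (Δ (g n)) := fun n => hΔm _ (hgm n)
  set γ : X → ENNReal := fun x => ⨆ n, g n x
  set δ : Y → ENNReal := fun y => ⨅ n, Δ (g n) y
  have hγ : ∀ x, Filter.Tendsto (fun n => g n x) Filter.atTop (nhds (γ x)) := fun x =>
    tendsto_atTop_iSup fun _ _ h => hg h x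
  have hδ : ∀ y, Filter.Tendsto (fun n => Δ (g n) y) Filter.atTop (nhds (δ y)) := fun y =>
    tendsto_atTop_iInf fun _ _ h => hd h y
  have row : ∀ x, Filter.Tendsto
      (fun n => clippedEnergy ν (fun y => F (x, y)) (Δ (g n)) (g (n + 1) x)) Filter.atTop
      (nhds (∫⁻ y, clippedRatio (F (x, y)) (max (γ x) (δ y)) ^ 2 ∂ν)) := fun x =>
    tendsto_lintegral_clippedRatio_sq ν (hFl x) (fun _ => hF' _)
      (fun n => measurable_const.max (hdm n))
      fun y => ((Filter.tendsto_add_atTop_iff_nat 1).2 (hγ x)).max (hδ y)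
  have col : ∀ y, Filter.Tendsto
      (fun n => clippedEnergy μ (fun x => F (x, y)) (g n) (Δ (g n) y)) Filter.atTop
      (nhds (∫⁻ x, clippedRatio (F (x, y)) (max (γ x) (δ y)) ^ 2 ∂μ)) := fun y => by
    simp_rw [max_comm (γ _)]
    exact tendsto_lintegral_clippedRatio_sq μ (hFr y) (fun _ => hF' _)
      (fun n => measurable_const.max (hgm n)) fun x => (hδ y).max (hγ x)
  refine ⟨γ, δ, .iSup hgm, .iInf hdm, fun x => ?_, fun x hx => ?_, fun y => ?_, fun y hy => ?_⟩
  · refine le_of_tendsto' (row x) fun n => ?_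
    rw [hgs]
    exact clippedEnergy_energyThreshold_le ν (hFl x) (fun _ => hF' _) (hdm n)
  · refine tendsto_nhds_unique (row x) (tendsto_const_nhds.congr' ?_)
    have := ((Filter.tendsto_add_atTop_iff_nat 1).2 (hγ x)).eventually_ne hx
    filter_upwards [this] with n hn
    rw [hgs] at hn ⊢
    exact (clippedEnergy_energyThreshold_eq ν (hFl x) (fun _ => hF' _) (hdm n) hn).symm
  · exact le_of_tendsto' (col y) fun n =>
      clippedEnergy_energyThreshold_le μ (hFr y) (fun _ => hF' _) (hgm n)
  · refine tendsto_nhds_unique (col y) (tendsto_const_nhds.congr' ?_)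
    filter_upwards [(hδ y).eventually_ne hy] with n hn
    exact (clippedEnergy_energyThreshold_eq μ (hFr y) (fun _ => hF' _) (hgm n) hn).symm

end Threshold

section Decomposition

variable {X Y : Type*} [MeasurableSpace X] [MeasurableSpace Y]

theorem sqrt_lintegral_sq_le_lintegral_mul_clippedRatio (ν : Measure Y) {G m : Y → ENNReal}
    (hG : Measurable G) (hm : Measurable m) {t : ENNReal} (htm : ∀ y, t ≤ m y)
    (h1 : ∫⁻ y, clippedRatio (G y) (m y) ^ 2 ∂ν = 1) (P : Y → Prop) [DecidablePred P]
    (hP : ∀ y, P y → m y = t ∧ G y < m y) :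
    (∫⁻ y, (if P y then G y ^ 2 else 0) ∂ν) ^ (1 / 2 : ℝ) ≤
      ∫⁻ y, G y * clippedRatio (G y) (m y) ∂ν := by
  have ht : t ≠ ⊤ := by
    rintro rfl
    have : ∀ y, m y = ⊤ := fun y => top_le_iff.1 (htm y)
    simp [this, clippedRatio_top] at h1
  have key : t ≤ ∫⁻ y, G y * clippedRatio (G y) (m y) ∂ν := calc
    t = ∫⁻ y, t * clippedRatio (G y) (m y) ^ 2 ∂ν := by
      rw [lintegral_const_mul _ (by fun_prop), h1, mul_one]
    _ ≤ _ := lintegral_mono fun y => by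
      rw [sq, ← mul_assoc]
      gcongr
      exact (mul_le_mul_left (htm y) _).trans (mul_clippedRatio_le _ _)
  have sq_le : ∫⁻ y, (if P y then G y ^ 2 else 0) ∂ν ≤
      (∫⁻ y, G y * clippedRatio (G y) (m y) ∂ν) ^ 2 := calc
    _ ≤ ∫⁻ y, t * (G y * clippedRatio (G y) (m y)) ∂ν := lintegral_mono fun y => by
      split_ifs with h
      · obtain ⟨h2, h3⟩ := hP y h
        rw [mul_left_comm, ← h2, mul_clippedRatio_eq h3 (h2 ▸ ht), sq]
      · exact zero_le
    _ = t * ∫⁻ y, G y * clippedRatio (G y) (m y) ∂ν := lintegral_const_mul _ (by fun_prop)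
    _ ≤ _ := by rw [sq]; gcongr
  calc _ ≤ ((∫⁻ y, G y * clippedRatio (G y) (m y) ∂ν) ^ 2) ^ (1 / 2 : ℝ) := by gcongr
    _ = _ := by
      rw [← ENNReal.rpow_natCast, ← ENNReal.rpow_mul]
      norm_num

/-- The colour of a point with value `u` and levels `m`, `b`, `c`. -/
def levelColour (u m b c : ENNReal) : Fin 4 :=
  if m ≤ u then 0 else if m = b then 1 else if m = c then 2 else 3

theorem levelColour_eq_zero {u m b c : ENNReal} (h : levelColour u m b c = 0) : m ≤ u := by
  unfold levelColour at h
  split_ifs at h <;> simp_all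

theorem levelColour_eq_one {u m b c : ENNReal} (h : levelColour u m b c = 1) :
    m = b ∧ u < m := by
  unfold levelColour at h
  split_ifs at h <;> simp_all

theorem levelColour_eq_two {u m b c : ENNReal} (h : levelColour u m b c = 2) :
    m ≠ b ∧ m = c ∧ u < m := by
  unfold levelColour at h
  split_ifs at h <;> simp_all

theorem levelColour_eq_three {u m b c : ENNReal} (h : levelColour u m b c = 3) :
    m ≠ b ∧ m ≠ c ∧ u < m := by
  unfold levelColour at h
  split_ifs at h <;> simp_all

/-- A weight `h` in the unit balls of `L^∞`, `L²`, `L^∞(L²)` in both orders, and a measurable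
four-colouring `κ`, such that the pairing of `F` with `h` dominates the four mixed norms of the
restrictions of `F` to the colour classes. -/
theorem exists_weight_and_colouring (μ : Measure X) (ν : Measure Y) [IsFiniteMeasure μ]
    [IsFiniteMeasure ν] {F : X × Y → ENNReal} (hF : Measurable F) (hF' : ∀ z, F z ≠ ⊤) :
    ∃ (h : X × Y → ENNReal) (κ : X × Y → Fin 4), Measurable h ∧ Measurable κ ∧
      (∀ z, h z ≤ 1) ∧ (∀ x, ∫⁻ y, h (x, y) ^ 2 ∂ν ≤ 1) ∧ (∀ y, ∫⁻ x, h (x, y) ^ 2 ∂μ ≤ 1) ∧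
      (∫⁻ z, h z ^ 2 ∂(μ.prod ν) ≤ 1) ∧
      (∫⁻ z, (if κ z = 0 then F z else 0) ∂(μ.prod ν) ≤ ∫⁻ z, F z * h z ∂(μ.prod ν)) ∧
      ((∫⁻ z, (if κ z = 1 then F z ^ 2 else 0) ∂(μ.prod ν)) ^ (1 / 2 : ℝ) ≤
        ∫⁻ z, F z * h z ∂(μ.prod ν)) ∧
      (∫⁻ x, (∫⁻ y, (if κ (x, y) = 2 then F (x, y) ^ 2 else 0) ∂ν) ^ (1 / 2 : ℝ) ∂μ ≤
        ∫⁻ z, F z * h z ∂(μ.prod ν)) ∧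
      (∫⁻ y, (∫⁻ x, (if κ (x, y) = 3 then F (x, y) ^ 2 else 0) ∂μ) ^ (1 / 2 : ℝ) ∂ν ≤
        ∫⁻ z, F z * h z ∂(μ.prod ν)) := by
  obtain ⟨γ, δ, hγ, hδ, hrow, hrow', hcol, hcol'⟩ := exists_mutual_energyThreshold ν μ hF hF'
  set w : X × Y → ENNReal := fun z => max (γ z.1) (δ z.2)
  have hwm : Measurable w := by fun_prop
  set β := energyThreshold (μ.prod ν) F w
  have htot := clippedEnergy_energyThreshold_le (μ.prod ν) hF hF' hwm
  have htot' := clippedEnergy_energyThreshold_eq (μ.prod ν) hF hF' hwm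
  set m : X × Y → ENNReal := fun z => max β (w z)
  have hmm : Measurable m := by fun_prop
  set h : X × Y → ENNReal := fun z => clippedRatio (F z) (m z)
  have hhm : Measurable h := by fun_prop
  have hFl : ∀ x, Measurable fun y => F (x, y) := fun x => hF.comp measurable_prodMk_left
  have hFr : ∀ y, Measurable fun x => F (x, y) := fun y => hF.comp measurable_prodMk_right
  have hml : ∀ x, Measurable fun y => m (x, y) := fun x => hmm.comp measurable_prodMk_left
  have hmr : ∀ y, Measurable fun x => m (x, y) := fun y => hmm.comp measurable_prodMk_right
  have hle : ∀ z, h z ^ 2 ≤ clippedRatio (F z) (w z) ^ 2 := fun z =>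
    pow_le_pow_left' (clippedRatio_antitone _ (le_max_right _ _)) 2
  set κ : X × Y → Fin 4 := fun z => levelColour (F z) (m z) β (γ z.1)
  have hκ0 : ∀ z, κ z = 0 → m z ≤ F z := fun z => levelColour_eq_zero
  have hκ1 : ∀ z, κ z = 1 → m z = β ∧ F z < m z := fun z => levelColour_eq_one
  have hκ2 : ∀ z, κ z = 2 → m z ≠ β ∧ m z = γ z.1 ∧ F z < m z := fun z => levelColour_eq_two
  have hκ3 : ∀ z, κ z = 3 → m z ≠ β ∧ m z = δ z.2 ∧ F z < m z := by
    intro z hz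
    have h3 := levelColour_eq_three hz
    refine ⟨h3.1, ?_, h3.2.2⟩
    rcases max_choice β (w z) with h4 | h4
    · exact absurd h4 h3.1
    rcases max_choice (γ z.1) (δ z.2) with h5 | h5
    · exact absurd (h4.trans h5) h3.2.1
    · exact h4.trans h5
  refine ⟨h, κ, hhm, ?_, fun z => clippedRatio_le_one _ _,
    fun x => (lintegral_mono fun y => hle _).trans (hrow x),
    fun y => (lintegral_mono fun x => hle _).trans (hcol y), htot, ?_, ?_, ?_, ?_⟩
  · refine Measurable.ite (measurableSet_le hmm hF) measurable_const <|
      Measurable.ite (measurableSet_eq_fun hmm measurable_const) measurable_const <|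
      Measurable.ite (measurableSet_eq_fun hmm (hγ.comp measurable_fst)) measurable_const
        measurable_const
  · refine lintegral_mono fun z => ?_
    split_ifs with hz
    · exact (mul_clippedRatio_of_le (hκ0 z hz) (hF' z)).ge
    · exact zero_le
  · rcases eq_or_ne β 0 with h0 | h0
    · have : ∀ z, κ z ≠ 1 := fun z hz => by
        obtain ⟨h2, h3⟩ := hκ1 z hz
        simp [h2, h0] at h3
      simp [this]
    · exact sqrt_lintegral_sq_le_lintegral_mul_clippedRatio _ hF hmm (fun z => le_max_left _ _)
        (htot' h0) _ hκ1
  · rw [lintegral_prod _ (by fun_prop)]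
    refine lintegral_mono fun x => ?_
    by_cases hx : γ x ≤ β
    · have : ∀ y, κ (x, y) ≠ 2 := fun y hy => by
        obtain ⟨h1, h2, -⟩ := hκ2 _ hy
        exact h1 (le_antisymm (h2.trans_le hx) (le_max_left _ _))
      simp [this]
    · push Not at hx
      have hmx : ∀ y, m (x, y) = max (γ x) (δ y) := fun y =>
        max_eq_right (hx.le.trans (le_max_left _ _))
      refine sqrt_lintegral_sq_le_lintegral_mul_clippedRatio ν (hFl x) (hml x)
        (t := γ x) (fun y => ?_) ?_ _ fun y hy => (hκ2 _ hy).2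
      · rw [hmx]; exact le_max_left _ _
      · simp_rw [hmx]; exact hrow' x (zero_le.trans_lt hx).ne'
  · rw [lintegral_prod_symm _ (by fun_prop)]
    refine lintegral_mono fun y => ?_
    by_cases hy : δ y ≤ β
    · have : ∀ x, κ (x, y) ≠ 3 := fun x hx => by
        obtain ⟨h1, h2, -⟩ := hκ3 _ hx
        exact h1 (le_antisymm (h2.trans_le hy) (le_max_left _ _))
      simp [this]
    · push Not at hy
      have hmy : ∀ x, m (x, y) = max (γ x) (δ y) := fun x =>
        max_eq_right (hy.le.trans (le_max_right _ _))
      refine sqrt_lintegral_sq_le_lintegral_mul_clippedRatio μ (hFr y) (hmr y)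
        (t := δ y) (fun x => ?_) ?_ _ fun x hx => (hκ3 _ hx).2
      · rw [hmy]; exact le_max_right _ _
      · simp_rw [hmy]; exact hcol' y (zero_le.trans_lt hy).ne'

end Decomposition

section IndependentCoordinates

variable {Ω : Type*} [MeasurableSpace Ω]

theorem map_pair_eq_prod {μ : Measure Ω} [IsProbabilityMeasure μ] {ν : Measure (ℕ → Ω)}
    (hν : ∀ n : ℕ, ν.map (fun x (k : Fin n) => x k) = Measure.pi fun _ : Fin n => μ)
    {i k : ℕ} (hik : i ≠ k) : ν.map (fun x => (x i, x k)) = μ.prod μ := by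
  set n := max i k + 1
  set i' : Fin n := ⟨i, by omega⟩
  set k' : Fin n := ⟨k, by omega⟩
  have hne : i' ≠ k' := fun h => hik (congrArg Fin.val h)
  have h1 : ν.map (fun x => (x i, x k)) =
      (ν.map (fun x (k : Fin n) => x k)).map (fun v => (v i', v k')) := by
    rw [Measure.map_map (by fun_prop) (by fun_prop)]
    rfl
  have hind := (ProbabilityTheory.iIndepFun_pi (μ := fun _ : Fin n => μ)
    (X := fun _ => (id : Ω → Ω)) fun _ => aemeasurable_id).indepFun hne
  have hmap := (ProbabilityTheory.indepFun_iff_map_prod_eq_prod_map_map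
    (measurable_pi_apply i').aemeasurable (measurable_pi_apply k').aemeasurable).1 hind
  have hev : ∀ l : Fin n, (Measure.pi fun _ : Fin n => μ).map (fun v => v l) = μ := fun l =>
    (measurePreserving_eval (fun _ : Fin n => μ) l).map_eq
  rw [hev, hev] at hmap
  rw [h1, hν]
  exact hmap

theorem map_eval_eq {μ : Measure Ω} [IsProbabilityMeasure μ] {ν : Measure (ℕ → Ω)}
    (hν : ∀ n : ℕ, ν.map (fun x (k : Fin n) => x k) = Measure.pi fun _ : Fin n => μ) (i : ℕ) :
    ν.map (fun x => x i) = μ := by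
  have := congrArg (Measure.map Prod.fst) (map_pair_eq_prod hν (Nat.ne_add_one i))
  rw [Measure.map_map (by fun_prop) (by fun_prop), Measure.map_fst_prod] at this
  simpa [Function.comp_def] using this

/-- The measure on `ℕ × Ω` whose slices are `μ` over the points of `s` and zero elsewhere. -/
abbrev sliceMeasure (s : Finset ℕ) (μ : Measure Ω) : Measure (ℕ × Ω) :=
  (Measure.count.restrict (s : Set ℕ)).prod μ

theorem lintegral_sliceMeasure (s : Finset ℕ) (μ : Measure Ω) [SFinite μ] {φ : ℕ × Ω → ENNReal}
    (hφ : Measurable φ) : ∫⁻ z, φ z ∂(sliceMeasure s μ) = ∑ i ∈ s, ∫⁻ a, φ (i, a) ∂μ := by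
  rw [lintegral_prod _ hφ.aemeasurable, lintegral_finset]
  simp

instance (s : Finset ℕ) : IsFiniteMeasure (Measure.count.restrict (s : Set ℕ)) :=
  ⟨by simp⟩

theorem lintegral_sliceMeasure_prod (s : Finset ℕ) (μ : Measure Ω) [SFinite μ]
    {φ : (ℕ × Ω) × (ℕ × Ω) → ENNReal} (hφ : Measurable φ) :
    ∫⁻ z, φ z ∂((sliceMeasure s μ).prod (sliceMeasure s μ)) =
      ∑ p ∈ s ×ˢ s, ∫⁻ z, φ ((p.1, z.1), (p.2, z.2)) ∂(μ.prod μ) := by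
  have hm : ∀ i j, Measurable fun z : Ω × Ω => φ ((i, z.1), (j, z.2)) := fun i j =>
    hφ.comp (by fun_prop)
  rw [lintegral_prod _ hφ.aemeasurable,
    lintegral_sliceMeasure s μ hφ.lintegral_prod_right', Finset.sum_product]
  refine Finset.sum_congr rfl fun i _ => ?_
  simp_rw [lintegral_prod _ (hm _ _).aemeasurable]
  rw [← lintegral_finsetSum _ fun j _ => (hm i j).lintegral_prod_right']
  exact lintegral_congr fun a => lintegral_sliceMeasure s μ
    (hφ.comp (by fun_prop : Measurable fun y : ℕ × Ω => ((i, a), y)))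

theorem lintegral_eval_eq {μ : Measure Ω} {ν : Measure (ℕ → Ω)} (hν1 : ∀ i, ν.map (fun x => x i) = μ) (i : ℕ) {φ : Ω → ENNReal}
    (hφ : Measurable φ) : ∫⁻ x, φ (x i) ∂ν = ∫⁻ a, φ a ∂μ := by
  rw [← hν1 i, lintegral_map hφ (by fun_prop)]

variable {μ : Measure Ω} [IsProbabilityMeasure μ] {ν : Measure (ℕ → Ω)}

theorem lintegral_sum_pair_le (hν1 : ∀ i, ν.map (fun x => x i) = μ)
    (hν2 : ∀ i k, i ≠ k → ν.map (fun x => (x i, x k)) = μ.prod μ)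
    (s : Finset ℕ) (i : ℕ) {K : ℕ → Ω × Ω → ENNReal} (hK : ∀ k, Measurable (K k)) :
    ∫⁻ x, ∑ k ∈ s, K k (x i, x k) ∂ν ≤
      ∑ k ∈ s, ∫⁻ a, ∫⁻ b, K k (a, b) ∂μ ∂μ + ∫⁻ a, K i (a, a) ∂μ := by
  have hm : ∀ k, Measurable fun x : ℕ → Ω => K k (x i, x k) := fun k =>
    (hK k).comp (by fun_prop)
  have hne : ∀ k, k ≠ i → ∫⁻ x, K k (x i, x k) ∂ν = ∫⁻ a, ∫⁻ b, K k (a, b) ∂μ ∂μ := fun k hk => by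
    rw [← lintegral_prod _ (hK k).aemeasurable, ← hν2 i k hk.symm,
      lintegral_map (hK k) (by fun_prop)]
  have heq : ∫⁻ x, K i (x i, x i) ∂ν = ∫⁻ a, K i (a, a) ∂μ :=
    lintegral_eval_eq hν1 i (φ := fun a => K i (a, a)) ((hK i).comp (by fun_prop))
  rw [lintegral_finsetSum _ fun k _ => hm k]
  by_cases hi : i ∈ s
  · rw [← Finset.sum_erase_add _ _ hi, heq]
    gcongr ?_ + _
    rw [Finset.sum_congr rfl fun k hk => hne k (Finset.ne_of_mem_erase hk)]
    exact Finset.sum_le_sum_of_subset (Finset.erase_subset _ _)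
  · rw [Finset.sum_congr rfl fun k hk => hne k (ne_of_mem_of_not_mem hk hi)]
    exact le_self_add

theorem lintegral_mul_sum_sum_le (hν1 : ∀ i, ν.map (fun x => x i) = μ)
    (hν2 : ∀ i k, i ≠ k → ν.map (fun x => (x i, x k)) = μ.prod μ)
    (s : Finset ℕ) {u : (ℕ × Ω) × (ℕ × Ω) → ENNReal} (hu : Measurable u) (hu1 : ∀ z, u z ≤ 1)
    (hrow : ∀ x, ∫⁻ y, u (x, y) ∂(sliceMeasure s μ) ≤ 1)
    (hcol : ∀ y, ∫⁻ x, u (x, y) ∂(sliceMeasure s μ) ≤ 1)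
    (htot : ∫⁻ z, u z ∂((sliceMeasure s μ).prod (sliceMeasure s μ)) ≤ 1)
    (i j : ℕ) {g : Ω × Ω → ENNReal} (hg : Measurable g) :
    ∫⁻ x, ∫⁻ y, g (x i, y j) * ∑ k ∈ s, ∑ l ∈ s, u ((k, x k), (l, y l)) ∂ν ∂ν ≤
      4 * ∫⁻ a, ∫⁻ b, g (a, b) ∂μ ∂μ := by
  set V : ℕ × Ω → Ω → ENNReal := fun z b => ∫⁻ y, u (z, y) ∂(sliceMeasure s μ) + u (z, (j, b))
    with hV
  have hR : Measurable fun z => ∫⁻ y, u (z, y) ∂(sliceMeasure s μ) := hu.lintegral_prod_right'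
  have hVm : Measurable fun q : (ℕ × Ω) × Ω => V q.1 q.2 :=
    (hR.comp measurable_fst).add (hu.comp (by fun_prop))
  have hV2 : ∀ z b, V z b ≤ 2 := fun z b => by
    rw [← one_add_one_eq_two]
    exact add_le_add (hrow z) (hu1 _)
  have hVint : ∀ b, ∑ k ∈ s, ∫⁻ a, V (k, a) b ∂μ ≤ 2 := fun b => by
    have hub : Measurable fun z : ℕ × Ω => u (z, (j, b)) := hu.comp (by fun_prop)
    rw [← lintegral_sliceMeasure s μ (φ := fun z => V z b) (hR.add hub),
      lintegral_add_left hR, ← one_add_one_eq_two, ← lintegral_prod _ hu.aemeasurable]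
    exact add_le_add htot (hcol _)
  have inner : ∀ x : ℕ → Ω, ∫⁻ y, g (x i, y j) * ∑ k ∈ s, ∑ l ∈ s, u ((k, x k), (l, y l)) ∂ν ≤
      ∑ k ∈ s, ∫⁻ b, g (x i, b) * V (k, x k) b ∂μ := fun x => by
    have hgx : Measurable fun b => g (x i, b) := hg.comp (by fun_prop)
    have hux : ∀ k l, Measurable fun b => u ((k, x k), (l, b)) := fun k l => hu.comp (by fun_prop)
    calc _ = ∑ k ∈ s, ∫⁻ y, ∑ l ∈ s, g (x i, y j) * u ((k, x k), (l, y l)) ∂ν := by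
          rw [← lintegral_finsetSum]
          · simp_rw [Finset.mul_sum]
          · intro k _
            refine Finset.measurable_fun_sum _ fun l _ => ?_
            exact (hgx.comp (measurable_pi_apply j)).mul ((hux k l).comp (measurable_pi_apply l))
      _ ≤ ∑ k ∈ s, (∑ l ∈ s, ∫⁻ a, ∫⁻ b, g (x i, a) * u ((k, x k), (l, b)) ∂μ ∂μ +
            ∫⁻ b, g (x i, b) * u ((k, x k), (j, b)) ∂μ) := by
          gcongr with k
          exact lintegral_sum_pair_le hν1 hν2 s j
            (K := fun l q => g (x i, q.1) * u ((k, x k), (l, q.2))) fun l =>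
              (hgx.comp measurable_fst).mul ((hux k l).comp measurable_snd)
      _ = _ := by
          refine Finset.sum_congr rfl fun k _ => ?_
          simp_rw [hV, mul_add]
          have hgu : Measurable fun b => g (x i, b) * u ((k, x k), (j, b)) := hgx.mul (hux k j)
          rw [lintegral_add_right _ hgu, lintegral_mul_const _ hgx,
            lintegral_sliceMeasure s μ (φ := fun y => u ((k, x k), y)) (hu.comp (by fun_prop)),
            Finset.mul_sum]
          congr 1
          refine Finset.sum_congr rfl fun l _ => ?_
          rw [← lintegral_mul_const _ hgx]
          exact lintegral_congr fun a => lintegral_const_mul _ (hux k l)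
  have hW : ∀ k, Measurable fun q : (Ω × Ω) × Ω => g (q.1.1, q.2) * V (k, q.1.2) q.2 := fun k =>
    (hg.comp (by fun_prop)).mul
      (hVm.comp (f := fun q : (Ω × Ω) × Ω => ((k, q.1.2), q.2)) (by fun_prop))
  have hgm : ∀ a, Measurable fun b => g (a, b) := fun a => hg.comp (by fun_prop)
  have hVk : ∀ k b, Measurable fun a => V (k, a) b := fun k b =>
    hVm.comp (f := fun a => ((k, a), b)) (by fun_prop)
  calc _ ≤ ∫⁻ x, ∑ k ∈ s, ∫⁻ b, g (x i, b) * V (k, x k) b ∂μ ∂ν := lintegral_mono inner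
    _ ≤ ∑ k ∈ s, ∫⁻ a, ∫⁻ a', ∫⁻ b, g (a, b) * V (k, a') b ∂μ ∂μ ∂μ +
        ∫⁻ a, ∫⁻ b, g (a, b) * V (i, a) b ∂μ ∂μ :=
      lintegral_sum_pair_le hν1 hν2 s i
        (K := fun k q => ∫⁻ b, g (q.1, b) * V (k, q.2) b ∂μ) fun k => (hW k).lintegral_prod_right'
    _ ≤ 2 * ∫⁻ a, ∫⁻ b, g (a, b) ∂μ ∂μ + 2 * ∫⁻ a, ∫⁻ b, g (a, b) ∂μ ∂μ := by
      gcongr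
      · rw [← lintegral_finsetSum _ fun k _ => Measurable.lintegral_prod_right'
          (f := fun q : Ω × Ω => ∫⁻ b, g (q.1, b) * V (k, q.2) b ∂μ) (hW k).lintegral_prod_right',
          ← lintegral_const_mul _ hg.lintegral_prod_right']
        refine lintegral_mono fun a => ?_
        calc _ = ∑ k ∈ s, ∫⁻ b, g (a, b) * ∫⁻ a', V (k, a') b ∂μ ∂μ := by
              refine Finset.sum_congr rfl fun k _ => ?_
              rw [lintegral_lintegral_swap]
              · exact lintegral_congr fun b => lintegral_const_mul (g (a, b)) (hVk k b)
              · exact ((hW k).comp (f := fun q : Ω × Ω => ((a, q.1), q.2))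
                  (by fun_prop)).aemeasurable
          _ = ∫⁻ b, g (a, b) * ∑ k ∈ s, ∫⁻ a', V (k, a') b ∂μ ∂μ := by
              rw [← lintegral_finsetSum]
              · simp_rw [Finset.mul_sum]
              · intro k _
                refine (hgm a).mul (Measurable.lintegral_prod_right'
                  (f := fun q : Ω × Ω => V (k, q.2) q.1) ?_)
                exact hVm.comp (f := fun q : Ω × Ω => ((k, q.2), q.1)) (by fun_prop)
          _ ≤ ∫⁻ b, 2 * g (a, b) ∂μ := lintegral_mono fun b => by
              rw [mul_comm]
              gcongr
              exact hVint b
          _ = _ := lintegral_const_mul _ (hgm a)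
      · rw [← lintegral_const_mul _ hg.lintegral_prod_right']
        refine lintegral_mono fun a => ?_
        rw [← lintegral_const_mul _ (hgm a)]
        refine lintegral_mono fun b => ?_
        rw [mul_comm]
        gcongr
        exact hV2 _ _
    _ = _ := by rw [← add_mul]; norm_num

theorem twelve_mul_sum_mul_le {ι : Type*} (t : Finset ι) (f h : ι → ENNReal) (hh : ∀ i, h i ≤ 1) :
    12 * ∑ i ∈ t, f i * h i ≤
      16 * (∑ i ∈ t, f i ^ 2) ^ (1 / 2 : ℝ) + (∑ i ∈ t, f i * h i) * ∑ i ∈ t, h i ^ 2 := by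
  have hcs := ENNReal.inner_le_Lp_mul_Lq t f h Real.HolderConjugate.two_two
  simp only [ENNReal.rpow_two] at hcs
  set T := ∑ i ∈ t, f i * h i
  set R := (∑ i ∈ t, f i ^ 2) ^ (1 / 2 : ℝ)
  set H := ∑ i ∈ t, h i ^ 2
  have hH : H ≠ ⊤ := ENNReal.sum_ne_top.2 fun i _ =>
    ENNReal.pow_ne_top ((hh i).trans_lt ENNReal.one_lt_top).ne
  set K := H ^ (1 / 2 : ℝ) with hKdef
  have hK : K ≠ ⊤ := ENNReal.rpow_ne_top_of_nonneg (by norm_num) hH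
  have hKH : H = K ^ 2 := by
    rw [hKdef, ← ENNReal.rpow_natCast, ← ENNReal.rpow_mul]; norm_num
  rcases eq_or_ne R ⊤ with hR | hR
  · simp [hR]
  have hT : T ≠ ⊤ := (hcs.trans_lt (ENNReal.mul_lt_top hR.lt_top hK.lt_top)).ne
  rw [hKH]
  clear_value T R K
  lift R to NNReal using hR
  lift T to NNReal using hT
  lift K to NNReal using hK
  norm_cast at hcs ⊢
  have h1 : (T : ℝ) ≤ R * K := by exact_mod_cast hcs
  rw [← NNReal.coe_le_coe]
  push_cast
  have hT0 := T.coe_nonneg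
  have hR0 := R.coe_nonneg
  have hK0 := K.coe_nonneg
  rcases le_or_gt ((K : ℝ) ^ 2) 12 with h2 | h2
  · nlinarith [mul_le_mul_of_nonneg_right h1 (sub_nonneg.2 h2),
      mul_nonneg hR0 (mul_nonneg (sq_nonneg ((K : ℝ) - 2)) (by linarith : (0:ℝ) ≤ K + 4))]
  · nlinarith

/-- A weight in the unit balls of `L^∞`, `L²` and both `L^∞(L²)` pairs with `F` to at most twice
the decoupled `L¹` norm of the square function. -/
theorem lintegral_mul_weight_le (hν1 : ∀ i, ν.map (fun x => x i) = μ)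
    (hν2 : ∀ i k, i ≠ k → ν.map (fun x => (x i, x k)) = μ.prod μ)
    (s : Finset ℕ) {F h : (ℕ × Ω) × (ℕ × Ω) → ENNReal} (hF : Measurable F) (hh : Measurable h)
    (hFfin : ∫⁻ z, F z ∂((sliceMeasure s μ).prod (sliceMeasure s μ)) ≠ ⊤)
    (hh1 : ∀ z, h z ≤ 1)
    (hrow : ∀ x, ∫⁻ y, h (x, y) ^ 2 ∂(sliceMeasure s μ) ≤ 1)
    (hcol : ∀ y, ∫⁻ x, h (x, y) ^ 2 ∂(sliceMeasure s μ) ≤ 1)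
    (htot : ∫⁻ z, h z ^ 2 ∂((sliceMeasure s μ).prod (sliceMeasure s μ)) ≤ 1) :
    ∫⁻ z, F z * h z ∂((sliceMeasure s μ).prod (sliceMeasure s μ)) ≤
      2 * ∫⁻ x, ∫⁻ y, (∑ p ∈ s ×ˢ s, F ((p.1, x p.1), (p.2, y p.2)) ^ 2) ^ (1 / 2 : ℝ) ∂ν ∂ν := by
  have : IsProbabilityMeasure ν := ⟨by
    have h := congrArg (fun m => m Set.univ) (hν1 0)
    simpa [Measure.map_apply (measurable_pi_apply 0) MeasurableSet.univ] using h⟩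
  set g : ℕ × ℕ → Ω × Ω → ENNReal := fun p z =>
    F ((p.1, z.1), (p.2, z.2)) * h ((p.1, z.1), (p.2, z.2)) with hg
  have hgm : ∀ p, Measurable (g p) := fun p =>
    (hF.comp (by fun_prop)).mul (hh.comp (by fun_prop))
  have hev : ∀ p : ℕ × ℕ, Measurable fun q : (ℕ → Ω) × (ℕ → Ω) => (q.1 p.1, q.2 p.2) := fun p => by
    fun_prop
  have hev' : ∀ p : ℕ × ℕ, Measurable fun q : (ℕ → Ω) × (ℕ → Ω) =>
      ((p.1, q.1 p.1), (p.2, q.2 p.2)) := fun p => by fun_prop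
  have hTm : ∀ p, Measurable fun q : (ℕ → Ω) × (ℕ → Ω) => g p (q.1 p.1, q.2 p.2) := fun p =>
    (hgm p).comp (hev p)
  set I := ∫⁻ z, F z * h z ∂((sliceMeasure s μ).prod (sliceMeasure s μ)) with hI
  have hI_sum : I = ∑ p ∈ s ×ˢ s, ∫⁻ a, ∫⁻ b, g p (a, b) ∂μ ∂μ := by
    rw [hI, lintegral_sliceMeasure_prod s μ (φ := fun z => F z * h z) (hF.mul hh)]
    exact Finset.sum_congr rfl fun p _ => lintegral_prod _ (hgm p).aemeasurable
  have hIfin : I ≠ ⊤ := ne_top_of_le_ne_top hFfin <| lintegral_mono fun z => by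
    simpa using mul_le_mul_right (hh1 z) (F z)
  have hET : ∫⁻ q, ∑ p ∈ s ×ˢ s, g p (q.1 p.1, q.2 p.2) ∂(ν.prod ν) = I := by
    rw [lintegral_finsetSum _ fun p _ => hTm p, hI_sum]
    refine Finset.sum_congr rfl fun p _ => ?_
    rw [lintegral_prod _ (hTm p).aemeasurable,
      ← lintegral_eval_eq hν1 p.1 (hgm p).lintegral_prod_right']
    exact lintegral_congr fun x => lintegral_eval_eq hν1 p.2 (φ := fun b => g p (x p.1, b))
      ((hgm p).comp (by fun_prop))
  have hHm : Measurable fun q : (ℕ → Ω) × (ℕ → Ω) =>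
      ∑ p ∈ s ×ˢ s, h ((p.1, q.1 p.1), (p.2, q.2 p.2)) ^ 2 :=
    Finset.measurable_fun_sum _ fun p _ => (hh.comp (hev' p)).pow_const 2
  have hRm : Measurable fun q : (ℕ → Ω) × (ℕ → Ω) =>
      (∑ p ∈ s ×ˢ s, F ((p.1, q.1 p.1), (p.2, q.2 p.2)) ^ 2) ^ (1 / 2 : ℝ) :=
    (Finset.measurable_fun_sum _ fun p _ => (hF.comp (hev' p)).pow_const 2).pow_const _
  have hTHm : ∀ p, Measurable fun q : (ℕ → Ω) × (ℕ → Ω) => g p (q.1 p.1, q.2 p.2) *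
      ∑ p ∈ s ×ˢ s, h ((p.1, q.1 p.1), (p.2, q.2 p.2)) ^ 2 := fun p => (hTm p).mul hHm
  have hETH : ∫⁻ q, (∑ p ∈ s ×ˢ s, g p (q.1 p.1, q.2 p.2)) *
      ∑ p ∈ s ×ˢ s, h ((p.1, q.1 p.1), (p.2, q.2 p.2)) ^ 2 ∂(ν.prod ν) ≤ 4 * I := by
    simp_rw [Finset.sum_mul]
    rw [lintegral_finsetSum _ fun p _ => hTHm p, hI_sum, Finset.mul_sum]
    refine Finset.sum_le_sum fun p _ => ?_
    rw [lintegral_prod _ (hTHm p).aemeasurable]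
    simp_rw [Finset.sum_product]
    exact lintegral_mul_sum_sum_le hν1 hν2 s (hh.pow_const 2)
      (fun z => pow_le_one' (hh1 z) 2) hrow hcol htot p.1 p.2 (hgm p)
  set R := ∫⁻ x, ∫⁻ y, (∑ p ∈ s ×ˢ s, F ((p.1, x p.1), (p.2, y p.2)) ^ 2) ^ (1 / 2 : ℝ) ∂ν ∂ν
    with hR
  have main : 12 * I ≤ 16 * R + 4 * I := calc
    12 * I = ∫⁻ q, 12 * ∑ p ∈ s ×ˢ s, g p (q.1 p.1, q.2 p.2) ∂(ν.prod ν) := by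
      rw [lintegral_const_mul _ (Finset.measurable_fun_sum _ fun p _ => hTm p), hET]
    _ ≤ ∫⁻ q, (16 * (∑ p ∈ s ×ˢ s, F ((p.1, q.1 p.1), (p.2, q.2 p.2)) ^ 2) ^ (1 / 2 : ℝ) +
          (∑ p ∈ s ×ˢ s, g p (q.1 p.1, q.2 p.2)) *
            ∑ p ∈ s ×ˢ s, h ((p.1, q.1 p.1), (p.2, q.2 p.2)) ^ 2) ∂(ν.prod ν) :=
      lintegral_mono fun q => twelve_mul_sum_mul_le _ _ _ fun p => hh1 _
    _ ≤ 16 * R + 4 * I := by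
      rw [lintegral_add_left (hRm.const_mul 16), lintegral_const_mul _ hRm,
        lintegral_prod _ hRm.aemeasurable]
      gcongr
  rcases eq_or_ne R ⊤ with hRtop | hRtop
  · simp [hRtop]
  clear_value I R
  lift I to NNReal using hIfin
  lift R to NNReal using hRtop
  norm_cast at main ⊢
  rw [← NNReal.coe_le_coe] at main ⊢
  push_cast at main ⊢
  linarith

end IndependentCoordinates

theorem ofReal_sqrt_sum_integral_sq_le {ι Y : Type*} [MeasurableSpace Y] (μ : Measure Y)
    (t : Finset ι) (φ : ι → Y → ℝ) :
    ENNReal.ofReal (Real.sqrt (∑ j ∈ t, ∫ y, φ j y ^ 2 ∂μ)) ≤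
      (∑ j ∈ t, ∫⁻ y, ‖φ j y‖ₑ ^ 2 ∂μ) ^ (1 / 2 : ℝ) := by
  have h0 : ∀ j ∈ t, 0 ≤ ∫ y, φ j y ^ 2 ∂μ := fun j _ => integral_nonneg fun y => sq_nonneg _
  rw [Real.sqrt_eq_rpow, ← ENNReal.ofReal_rpow_of_nonneg (Finset.sum_nonneg h0) (by norm_num),
    ENNReal.ofReal_sum_of_nonneg h0]
  gcongr with j hj
  rw [← Real.enorm_of_nonneg (h0 j hj)]
  refine (enorm_integral_le_lintegral_enorm _).trans_eq ?_
  simp_rw [enorm_pow]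

theorem ofReal_sqrt_sum_sq {ι : Type*} (t : Finset ι) (v : ι → ℝ) :
    ENNReal.ofReal (Real.sqrt (∑ p ∈ t, v p ^ 2)) = (∑ p ∈ t, ‖v p‖ₑ ^ 2) ^ (1 / 2 : ℝ) := by
  rw [Real.sqrt_eq_rpow, ← ENNReal.ofReal_rpow_of_nonneg
    (Finset.sum_nonneg fun _ _ => sq_nonneg _) (by norm_num),
    ENNReal.ofReal_sum_of_nonneg fun _ _ => sq_nonneg _]
  simp_rw [← Real.enorm_of_nonneg (sq_nonneg _), enorm_pow]

theorem sqrt_sum_sq_le_sum_abs {ι : Type*} (t : Finset ι) (v : ι → ℝ) :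
    Real.sqrt (∑ p ∈ t, v p ^ 2) ≤ ∑ p ∈ t, |v p| := by
  rw [Real.sqrt_le_left (Finset.sum_nonneg fun _ _ => abs_nonneg _)]
  simp_rw [← sq_abs (v _)]
  exact Finset.sum_sq_le_sq_sum_of_nonneg fun _ _ => abs_nonneg _

theorem enorm_ite_mul_sq (P : Prop) [Decidable P] (v : ℝ) :
    ‖(if P then 1 else 0) * v‖ₑ ^ 2 = if P then ‖v‖ₑ ^ 2 else 0 := by
  split_ifs <;> simp

section Transfer

variable {Ω : Type*} [MeasurableSpace Ω] {μ : Measure Ω}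
  {f g : ℕ × ℕ → Ω × Ω → ℝ}

/-- The joint absolute value `((i, x), (j, y)) ↦ |g i j (x, y)|` of a family. -/
def jointEnorm (g : ℕ × ℕ → Ω × Ω → ℝ) (z : (ℕ × Ω) × (ℕ × Ω)) : ENNReal :=
  ‖g (z.1.1, z.2.1) (z.1.2, z.2.2)‖ₑ

theorem measurable_jointEnorm (hg : ∀ p, Measurable (g p)) : Measurable (jointEnorm g) := by
  have h : Measurable fun q : (ℕ × ℕ) × (Ω × Ω) => g q.1 q.2 :=
    measurable_from_prod_countable_right hg
  exact (h.comp (by fun_prop :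
    Measurable fun z : (ℕ × Ω) × (ℕ × Ω) => ((z.1.1, z.2.1), (z.1.2, z.2.2)))).enorm


theorem ofReal_tsum_integral_abs_le [SFinite μ]
    (s : Finset ℕ) (hfs : ∀ p, p ∉ s ×ˢ s → f p = 0) (hfg : ∀ p, f p =ᵐ[μ.prod μ] g p)
    (hg : ∀ p, Measurable (g p)) {κ : (ℕ × Ω) × (ℕ × Ω) → Fin 4} (hκ : Measurable κ)
    (c : Fin 4) :
    ENNReal.ofReal (∑' p : ℕ × ℕ,
      ∫ z, |(if κ ((p.1, z.1), (p.2, z.2)) = c then 1 else 0) * f p z| ∂(μ.prod μ)) ≤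
      ∫⁻ z, (if κ z = c then jointEnorm g z else 0)
        ∂((sliceMeasure s μ).prod (sliceMeasure s μ)) := by
  have hm : Measurable fun z => if κ z = c then jointEnorm g z else 0 :=
    Measurable.ite (hκ (measurableSet_singleton c)) (measurable_jointEnorm hg) measurable_const
  rw [tsum_eq_sum (s := s ×ˢ s) fun p hp => by simp [hfs p hp],
    ENNReal.ofReal_sum_of_nonneg fun p _ => integral_nonneg fun z => abs_nonneg _,
    lintegral_sliceMeasure_prod s μ hm]
  gcongr with p
  rw [← Real.enorm_of_nonneg (integral_nonneg fun z => abs_nonneg _)]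
  refine (enorm_integral_le_lintegral_enorm _).trans_eq (lintegral_congr_ae ?_)
  filter_upwards [hfg p] with z hz
  rw [hz, Real.enorm_abs]
  split_ifs <;> simp [jointEnorm]

theorem ofReal_sqrt_tsum_integral_sq_le [SFinite μ]
    (s : Finset ℕ) (hfs : ∀ p, p ∉ s ×ˢ s → f p = 0) (hfg : ∀ p, f p =ᵐ[μ.prod μ] g p)
    (hg : ∀ p, Measurable (g p)) {κ : (ℕ × Ω) × (ℕ × Ω) → Fin 4} (hκ : Measurable κ)
    (c : Fin 4) :
    ENNReal.ofReal (Real.sqrt (∑' p : ℕ × ℕ,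
      ∫ z, ((if κ ((p.1, z.1), (p.2, z.2)) = c then 1 else 0) * f p z) ^ 2 ∂(μ.prod μ))) ≤
      (∫⁻ z, (if κ z = c then jointEnorm g z ^ 2 else 0)
        ∂((sliceMeasure s μ).prod (sliceMeasure s μ))) ^ (1 / 2 : ℝ) := by
  have hm : Measurable fun z => if κ z = c then jointEnorm g z ^ 2 else 0 :=
    Measurable.ite (hκ (measurableSet_singleton c)) ((measurable_jointEnorm hg).pow_const 2)
      measurable_const
  rw [tsum_eq_sum (s := s ×ˢ s) fun p hp => by simp [hfs p hp],
    lintegral_sliceMeasure_prod s μ hm]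
  refine (ofReal_sqrt_sum_integral_sq_le _ _ _).trans_eq ?_
  congr 1
  refine Finset.sum_congr rfl fun p _ => lintegral_congr_ae ?_
  filter_upwards [hfg p] with z hz
  rw [hz, enorm_ite_mul_sq, jointEnorm]

theorem ofReal_tsum_integral_sqrt_row_le [SFinite μ]
    (s : Finset ℕ) (hfs : ∀ p, p ∉ s ×ˢ s → f p = 0) (hfg : ∀ p, f p =ᵐ[μ.prod μ] g p)
    (hg : ∀ p, Measurable (g p)) {κ : (ℕ × Ω) × (ℕ × Ω) → Fin 4} (hκ : Measurable κ)
    (c : Fin 4) :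
    ENNReal.ofReal (∑' i : ℕ, ∫ x, Real.sqrt (∑' j : ℕ,
      ∫ y, ((if κ ((i, x), (j, y)) = c then 1 else 0) * f (i, j) (x, y)) ^ 2 ∂μ) ∂μ) ≤
      ∫⁻ x, (∫⁻ y, (if κ (x, y) = c then jointEnorm g (x, y) ^ 2 else 0)
        ∂(sliceMeasure s μ)) ^ (1 / 2 : ℝ) ∂(sliceMeasure s μ) := by
  have hm : Measurable fun z => if κ z = c then jointEnorm g z ^ 2 else 0 :=
    Measurable.ite (hκ (measurableSet_singleton c)) ((measurable_jointEnorm hg).pow_const 2)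
      measurable_const
  rw [tsum_eq_sum (s := s) fun i hi => by simp [hfs (i, _) (by simp [hi])],
    ENNReal.ofReal_sum_of_nonneg fun p _ => integral_nonneg fun z => Real.sqrt_nonneg _,
    lintegral_sliceMeasure s μ (hm.lintegral_prod_right'.pow_const _)]
  gcongr with i
  rw [← Real.enorm_of_nonneg (integral_nonneg fun z => Real.sqrt_nonneg _)]
  refine (enorm_integral_le_lintegral_enorm _).trans (lintegral_mono_ae ?_)
  have hae : ∀ᵐ x ∂μ, ∀ j, ∀ᵐ y ∂μ, f (i, j) (x, y) = g (i, j) (x, y) :=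
    ae_all_iff.2 fun j => Measure.ae_ae_of_ae_prod (hfg (i, j))
  filter_upwards [hae] with x hx
  have hmx : Measurable fun y => if κ ((i, x), y) = c then jointEnorm g ((i, x), y) ^ 2 else 0 :=
    hm.comp measurable_prodMk_left
  rw [Real.enorm_of_nonneg (Real.sqrt_nonneg _),
    tsum_eq_sum (s := s) fun j hj => by simp [hfs (i, j) (by simp [hj])],
    lintegral_sliceMeasure s μ hmx]
  refine (ofReal_sqrt_sum_integral_sq_le _ _ _).trans_eq ?_
  congr 1
  refine Finset.sum_congr rfl fun j _ => lintegral_congr_ae ?_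
  filter_upwards [hx j] with y hy
  rw [hy, enorm_ite_mul_sq, jointEnorm]

theorem ofReal_tsum_integral_sqrt_col_le [SFinite μ]
    (s : Finset ℕ) (hfs : ∀ p, p ∉ s ×ˢ s → f p = 0) (hfg : ∀ p, f p =ᵐ[μ.prod μ] g p)
    (hg : ∀ p, Measurable (g p)) {κ : (ℕ × Ω) × (ℕ × Ω) → Fin 4} (hκ : Measurable κ)
    (c : Fin 4) :
    ENNReal.ofReal (∑' j : ℕ, ∫ y, Real.sqrt (∑' i : ℕ,
      ∫ x, ((if κ ((i, x), (j, y)) = c then 1 else 0) * f (i, j) (x, y)) ^ 2 ∂μ) ∂μ) ≤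
      ∫⁻ y, (∫⁻ x, (if κ (x, y) = c then jointEnorm g (x, y) ^ 2 else 0)
        ∂(sliceMeasure s μ)) ^ (1 / 2 : ℝ) ∂(sliceMeasure s μ) :=
  ofReal_tsum_integral_sqrt_row_le (f := fun p z => f p.swap z.swap)
    (g := fun p z => g p.swap z.swap) s
    (fun p hp => by
      have : f p.swap = 0 := hfs _ (by simpa [and_comm] using hp)
      funext z
      simp [this])
    (fun p => Measure.measurePreserving_swap.quasiMeasurePreserving.ae_eq_comp (hfg p.swap))
    (fun p => (hg p.swap).comp measurable_swap) (κ := fun z => κ z.swap)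
    (hκ.comp measurable_swap) c

theorem ofReal_integral_integral_sqrt_eq
    (s : Finset ℕ) (hfs : ∀ p, p ∉ s ×ˢ s → f p = 0) (hfg : ∀ p, f p =ᵐ[μ.prod μ] g p)
    (hg : ∀ p, Measurable (g p))
    {ν : Measure (ℕ → Ω)} [IsProbabilityMeasure ν] (hν : ∀ i, ν.map (fun x => x i) = μ) (hf : ∀ p, Integrable (f p) (μ.prod μ)) :
    ENNReal.ofReal (∫ x, ∫ y, Real.sqrt (∑' p : ℕ × ℕ, f p (x p.1, y p.2) ^ 2) ∂ν ∂ν) =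
      ∫⁻ x, ∫⁻ y, (∑ p ∈ s ×ˢ s, jointEnorm g ((p.1, x p.1), (p.2, y p.2)) ^ 2) ^ (1 / 2 : ℝ)
        ∂ν ∂ν := by
  have hmp : ∀ p : ℕ × ℕ, MeasurePreserving
      (fun q : (ℕ → Ω) × (ℕ → Ω) => (q.1 p.1, q.2 p.2)) (ν.prod ν) (μ.prod μ) := fun p =>
    MeasurePreserving.prod ⟨measurable_pi_apply p.1, hν p.1⟩ ⟨measurable_pi_apply p.2, hν p.2⟩
  have hsum : ∀ x y : ℕ → Ω, ∑' p : ℕ × ℕ, f p (x p.1, y p.2) ^ 2 =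
      ∑ p ∈ s ×ˢ s, f p (x p.1, y p.2) ^ 2 := fun x y =>
    tsum_eq_sum fun p hp => by simp [hfs p hp]
  have hfi : ∀ p, Integrable (fun q : (ℕ → Ω) × (ℕ → Ω) => f p (q.1 p.1, q.2 p.2)) (ν.prod ν) :=
    fun p => (hmp p).integrable_comp_of_integrable (hf p)
  have hint : Integrable (fun q : (ℕ → Ω) × (ℕ → Ω) =>
      Real.sqrt (∑ p ∈ s ×ˢ s, f p (q.1 p.1, q.2 p.2) ^ 2)) (ν.prod ν) := by
    refine Integrable.mono' (integrable_finsetSum (s ×ˢ s) fun p _ => (hfi p).abs) ?_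
      (.of_forall fun q => ?_)
    · exact Real.continuous_sqrt.comp_aestronglyMeasurable
        (Finset.aestronglyMeasurable_fun_sum _ fun p _ => (hfi p).1.pow 2)
    · rw [Real.norm_of_nonneg (Real.sqrt_nonneg _)]
      exact sqrt_sum_sq_le_sum_abs _ _
  have hF := measurable_jointEnorm hg
  simp_rw [hsum]
  rw [← integral_prod _ hint, ofReal_integral_eq_lintegral_ofReal hint
    (.of_forall fun q => Real.sqrt_nonneg _)]
  have hae : ∀ᵐ q : (ℕ → Ω) × (ℕ → Ω) ∂(ν.prod ν), ∀ p : ℕ × ℕ,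
      f p (q.1 p.1, q.2 p.2) = g p (q.1 p.1, q.2 p.2) :=
    ae_all_iff.2 fun p => (hmp p).quasiMeasurePreserving.ae_eq_comp (hfg p)
  have hm : Measurable fun q : (ℕ → Ω) × (ℕ → Ω) =>
      (∑ p ∈ s ×ˢ s, jointEnorm g ((p.1, q.1 p.1), (p.2, q.2 p.2)) ^ 2) ^ (1 / 2 : ℝ) :=
    (Finset.measurable_fun_sum _ fun p _ => (hF.comp (by fun_prop)).pow_const 2).pow_const _
  rw [← lintegral_prod _ hm.aemeasurable]
  refine lintegral_congr_ae ?_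
  filter_upwards [hae] with q hq
  simp_rw [hq, ofReal_sqrt_sum_sq]
  rfl

theorem lintegral_jointEnorm_ne_top [SFinite μ] (s : Finset ℕ) (hg : ∀ p, Measurable (g p))
    (hgi : ∀ p, Integrable (g p) (μ.prod μ)) :
    ∫⁻ z, jointEnorm g z ∂((sliceMeasure s μ).prod (sliceMeasure s μ)) ≠ ⊤ := by
  rw [lintegral_sliceMeasure_prod s μ (measurable_jointEnorm hg)]
  exact ENNReal.sum_ne_top.2 fun p _ => (hgi p).2.ne

end Transfer

theorem exists_finset_prod_of_finite_support {M : Type*} [Zero M] {f : ℕ × ℕ → M}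
    (hf : (Function.support f).Finite) : ∃ s : Finset ℕ, ∀ p, p ∉ s ×ˢ s → f p = 0 := by
  classical
  refine ⟨hf.toFinset.image Prod.fst ∪ hf.toFinset.image Prod.snd, fun p hp => ?_⟩
  by_contra h
  have hmem : p ∈ hf.toFinset := hf.mem_toFinset.2 h
  exact hp (Finset.mem_product.2 ⟨Finset.mem_union_left _ (Finset.mem_image_of_mem _ hmem),
    Finset.mem_union_right _ (Finset.mem_image_of_mem _ hmem)⟩)


/-- four-summand decomposition: for a finitely supported family
`f_{i,j} ∈ L¹(Ω × Ω)` there is a partition of unity into `{0,1}`-valued functions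
`a_{i,j} + b_{i,j} + c_{i,j} + d_{i,j} = 1` such that the fully decoupled `L¹` norm of the
square function dominates, up to an absolute constant, the sum of the four mixed norms. -/
theorem statement7 :
    ∃ c₀ : ℝ, 0 < c₀ ∧
      ∀ (Ω : Type) [MeasurableSpace Ω] (μ : Measure Ω), IsProbabilityMeasure μ →
        ∀ (ν : Measure (ℕ → Ω)), IsProbabilityMeasure ν →
          (∀ n : ℕ, ν.map (fun x (k : Fin n) => x k) = Measure.pi fun _ : Fin n => μ) →
          ∀ f : ℕ × ℕ → Ω × Ω → ℝ,
            (∀ p : ℕ × ℕ, Integrable (f p) (μ.prod μ)) →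
            (Function.support f).Finite →
            ∃ a b c d : ℕ × ℕ → Ω × Ω → ℝ,
              (∀ p : ℕ × ℕ, Measurable (a p) ∧ Measurable (b p) ∧
                Measurable (c p) ∧ Measurable (d p)) ∧
              (∀ (p : ℕ × ℕ) (z : Ω × Ω),
                a p z ∈ ({0, 1} : Set ℝ) ∧ b p z ∈ ({0, 1} : Set ℝ) ∧
                c p z ∈ ({0, 1} : Set ℝ) ∧ d p z ∈ ({0, 1} : Set ℝ)) ∧
              (∀ (p : ℕ × ℕ) (z : Ω × Ω), a p z + b p z + c p z + d p z = 1) ∧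
              (∫ x, ∫ y, Real.sqrt (∑' p : ℕ × ℕ, (f p (x p.1, y p.2)) ^ 2) ∂ν ∂ν) ≥
                c₀ * ((∑' p : ℕ × ℕ, ∫ z, |a p z * f p z| ∂(μ.prod μ))
                  + Real.sqrt (∑' p : ℕ × ℕ, ∫ z, (b p z * f p z) ^ 2 ∂(μ.prod μ))
                  + (∑' i : ℕ, ∫ x, Real.sqrt (∑' j : ℕ,
                      ∫ y, (c (i, j) (x, y) * f (i, j) (x, y)) ^ 2 ∂μ) ∂μ)
                  + (∑' j : ℕ, ∫ y, Real.sqrt (∑' i : ℕ,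
                      ∫ x, (d (i, j) (x, y) * f (i, j) (x, y)) ^ 2 ∂μ) ∂μ)) := by
  refine ⟨1 / 8, by norm_num, fun Ω _ μ _ ν _ hν f hf hfin => ?_⟩
  have hν1 := map_eval_eq hν
  have hν2 : ∀ i k, i ≠ k → ν.map (fun x => (x i, x k)) = μ.prod μ := fun i k hik =>
    map_pair_eq_prod hν hik
  obtain ⟨s, hfs⟩ := exists_finset_prod_of_finite_support hfin
  set g : ℕ × ℕ → Ω × Ω → ℝ := fun p => (hf p).1.mk (f p)
  have hg : ∀ p, Measurable (g p) := fun p => (hf p).1.stronglyMeasurable_mk.measurable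
  have hfg : ∀ p, f p =ᵐ[μ.prod μ] g p := fun p => (hf p).1.ae_eq_mk
  have hgi : ∀ p, Integrable (g p) (μ.prod μ) := fun p => (hf p).congr (hfg p)
  obtain ⟨h, κ, hh, hκ, hh1, hrow, hcol, htot, hA, hB, hC, hD⟩ :=
    exists_weight_and_colouring (sliceMeasure s μ) (sliceMeasure s μ) (measurable_jointEnorm hg)
      fun z => enorm_ne_top
  have hI := lintegral_mul_weight_le hν1 hν2 s (measurable_jointEnorm hg) hh
    (lintegral_jointEnorm_ne_top s hg hgi) hh1 hrow hcol htot
  rw [← ofReal_integral_integral_sqrt_eq s hfs hfg hg hν1 hf] at hI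
  have hmem : ∀ (P : Prop) [Decidable P], (if P then 1 else 0 : ℝ) ∈ ({0, 1} : Set ℝ) := by
    intro P _
    split_ifs <;> simp
  have hmeas : ∀ (c : Fin 4) (p : ℕ × ℕ), Measurable fun z : Ω × Ω =>
      if κ ((p.1, z.1), (p.2, z.2)) = c then (1 : ℝ) else 0 := fun c p =>
    have hκp : Measurable fun z : Ω × Ω => κ ((p.1, z.1), (p.2, z.2)) := hκ.comp (by fun_prop)
    Measurable.ite (hκp (measurableSet_singleton c)) measurable_const measurable_const
  refine ⟨fun p z => if κ ((p.1, z.1), (p.2, z.2)) = 0 then 1 else 0,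
    fun p z => if κ ((p.1, z.1), (p.2, z.2)) = 1 then 1 else 0,
    fun p z => if κ ((p.1, z.1), (p.2, z.2)) = 2 then 1 else 0,
    fun p z => if κ ((p.1, z.1), (p.2, z.2)) = 3 then 1 else 0,
    fun p => ⟨hmeas 0 p, hmeas 1 p, hmeas 2 p, hmeas 3 p⟩,
    fun p z => ⟨hmem _, hmem _, hmem _, hmem _⟩, fun p z => ?_, ?_⟩
  · dsimp only
    generalize κ ((p.1, z.1), (p.2, z.2)) = c
    fin_cases c <;> simp
  have hL : 0 ≤ ∫ x, ∫ y, Real.sqrt (∑' p : ℕ × ℕ, (f p (x p.1, y p.2)) ^ 2) ∂ν ∂ν :=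
    integral_nonneg fun x => integral_nonneg fun y => Real.sqrt_nonneg _
  have bound : ∀ {r : ℝ} {J : ENNReal}, ENNReal.ofReal r ≤ J →
      J ≤ ∫⁻ z, jointEnorm g z * h z ∂((sliceMeasure s μ).prod (sliceMeasure s μ)) →
      r ≤ 2 * ∫ x, ∫ y, Real.sqrt (∑' p : ℕ × ℕ, (f p (x p.1, y p.2)) ^ 2) ∂ν ∂ν := by
    intro r J h1 h2
    have h3 := (h1.trans h2).trans hI
    rw [← ENNReal.ofReal_ofNat, ← ENNReal.ofReal_mul (by norm_num)] at h3
    exact (ENNReal.ofReal_le_ofReal_iff (by positivity)).1 h3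
  have h0 := bound (ofReal_tsum_integral_abs_le s hfs hfg hg hκ 0) hA
  have h1 := bound (ofReal_sqrt_tsum_integral_sq_le s hfs hfg hg hκ 1) hB
  have h2 := bound (ofReal_tsum_integral_sqrt_row_le s hfs hfg hg hκ 2) hC
  have h3 := bound (ofReal_tsum_integral_sqrt_col_le s hfs hfg hg hκ 3) hD
  linarith

end
end

section
/- Let (Ω,𝓕,μ) be a probability space, I, J finite sets, (𝓕_i)_{i∈I} a family of sub-σ-algebras of 𝓕, κ > 0, and for (i,j) ∈ I×J let w_{i,j} : Ω → [0,1] be measurable and f_{i,j} be integrable, 𝓕_i-measurable, and supported on the set {E(w_{i,j}|𝓕_i) ≥ κ}. Then E[(Σ_{(i,j)∈I×J} (w_{i,j} f_{i,j})²)^{1/2}] ≥ κ · (Σ_{(i,j)∈I×J} (E|f_{i,j}|)²)^{1/2}. -/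
open MeasureTheory

noncomputable section

/-- The `ℓ²` norm of the integrals is at most the integral of the `ℓ²` norm. -/
theorem sqrt_sum_sq_integral_le_integral_sqrt_sum_sq {Ω ι : Type*} [MeasurableSpace Ω]
    {μ : Measure Ω} [Fintype ι] {g : ι → Ω → ℝ} (hg : ∀ k, Integrable (g k) μ) :
    Real.sqrt (∑ k, (∫ x, g k x ∂μ) ^ 2) ≤ ∫ x, Real.sqrt (∑ k, (g k x) ^ 2) ∂μ := by
  have h := norm_integral_le_integral_norm (μ := μ)
    (fun x => (WithLp.toLp 2 (fun k => g k x) : EuclideanSpace ℝ ι))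
  simp only [EuclideanSpace.norm_eq, Real.norm_eq_abs, sq_abs] at h
  convert h using 5 with k
  exact (eval_integral_piLp (f := fun x => (WithLp.toLp 2 (fun k => g k x) : EuclideanSpace ℝ ι))
    hg k).symm

/-- If `f` is `m`-measurable and vanishes where `μ[w|m] < κ`, then integrating `|f|` against the
bounded weight `w` loses at most a factor `κ`. -/
theorem mul_integral_abs_le_integral_mul_abs {Ω : Type*} {m m0 : MeasurableSpace Ω}
    {μ : Measure Ω} [IsFiniteMeasure μ] (hm : m ≤ m0) {κ : ℝ} {w f : Ω → ℝ}
    (hw : ∀ x, w x ∈ Set.Icc (0 : ℝ) 1) (hwm : Measurable w) (hfi : Integrable f μ)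
    (hfm : Measurable[m] f) (hsupp : ∀ᵐ x ∂μ, (μ[w|m]) x < κ → f x = 0) :
    κ * ∫ x, |f x| ∂μ ≤ ∫ x, w x * |f x| ∂μ := by
  have hbound : ∀ x, ‖w x‖ ≤ 1 := fun x => by
    rw [Real.norm_of_nonneg (hw x).1]; exact (hw x).2
  have hwi : Integrable w μ :=
    .of_bound hwm.aestronglyMeasurable 1 (.of_forall hbound)
  have hwf : Integrable (fun x => w x * |f x|) μ :=
    hfi.abs.bdd_mul hwm.aestronglyMeasurable (.of_forall hbound)
  have habs : StronglyMeasurable[m] fun x => |f x| := by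
    simpa only [Real.norm_eq_abs] using hfm.stronglyMeasurable.norm
  have hpull : μ[fun x => w x * |f x| | m] =ᵐ[μ] fun x => (μ[w|m]) x * |f x| :=
    condExp_mul_of_stronglyMeasurable_right habs hwf hwi
  rw [← integral_condExp hm (f := fun x => w x * |f x|), integral_congr_ae hpull,
    ← integral_const_mul]
  refine integral_mono_ae (hfi.abs.const_mul κ) (integrable_condExp.congr hpull) ?_
  filter_upwards [hsupp] with x hx
  rcases lt_or_ge ((μ[w|m]) x) κ with h | h
  · simp [hx h]
  · exact mul_le_mul_of_nonneg_right h (abs_nonneg _)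

/-- if `w_{i,j} : Ω → [0,1]`, and `f_{i,j}` is integrable,
`𝓕_i`-measurable and supported on `{E(w_{i,j}|𝓕_i) ≥ κ}`, then
`E (Σ_{i,j} (w_{i,j} f_{i,j})²)^{1/2} ≥ κ (Σ_{i,j} (E|f_{i,j}|)²)^{1/2}`. -/
theorem statement12 {Ω : Type} [m0 : MeasurableSpace Ω]
    (μ : Measure Ω) [IsProbabilityMeasure μ]
    {I J : Type} [Fintype I] [Fintype J]
    (𝓕 : I → MeasurableSpace Ω) (h𝓕 : ∀ i, 𝓕 i ≤ m0)
    (κ : ℝ) (hκ : 0 < κ)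
    (w f : I → J → Ω → ℝ)
    (hw : ∀ i j x, w i j x ∈ Set.Icc (0 : ℝ) 1)
    (hwm : ∀ i j, Measurable (w i j))
    (hfi : ∀ i j, Integrable (f i j) μ)
    (hfm : ∀ i j, Measurable[𝓕 i] (f i j))
    (hsupp : ∀ i j, ∀ᵐ x ∂μ, (μ[w i j|𝓕 i]) x < κ → f i j x = 0) :
    ∫ x, Real.sqrt (∑ i : I, ∑ j : J, (w i j x * f i j x) ^ 2) ∂μ ≥
      κ * Real.sqrt (∑ i : I, ∑ j : J, (∫ x, |f i j x| ∂μ) ^ 2) := by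
  have hint : ∀ k : I × J, Integrable (fun x => w k.1 k.2 x * |f k.1 k.2 x|) μ := fun k =>
    (hfi k.1 k.2).abs.bdd_mul (c := 1) (hwm k.1 k.2).aestronglyMeasurable
      (.of_forall fun x => by
        rw [Real.norm_of_nonneg (hw k.1 k.2 x).1]; exact (hw k.1 k.2 x).2)
  have hmink := sqrt_sum_sq_integral_le_integral_sqrt_sum_sq hint
  simp only [Fintype.sum_prod_type, mul_pow, sq_abs] at hmink
  simp only [mul_pow]
  refine le_trans ?_ hmink
  rw [← Real.sqrt_sq hκ.le, ← Real.sqrt_mul (sq_nonneg κ)]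
  simp only [Finset.mul_sum, ← mul_pow]
  gcongr with i _ j
  exact mul_integral_abs_le_integral_mul_abs (h𝓕 i) (hw i j) (hwm i j) (hfi i j) (hfm i j)
    (hsupp i j)

end
end
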